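/- Let 2/3 < κ < 1 and let f : ℝ → ℝ be twice differentiable with f''(t) > 0 for all sufficiently large t and (log f''(t))/(log t) → −κ as t → ∞. Then there exists ε₀ > 0 such that for every ε with 0 < ε ≤ ε₀ there is a constant C > 0 (depending only on ε, κ and f) with the following property: setting δ = ε²κ⁴/2¹¹, for every prime p, every x, y ∈ 𝔽_p with y ≠ 0, and every integer N in the range p^{1/(2κ)+ε} ≤ N < p^{1/(2−κ)}, one has |∑_{n=1}^{N} ψ_{x,y;p}(⌊f(n)⌋ mod p)| ≤ C·N·p^{−δ}. -/

import Mathlib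

/-- `ψ_{x,y;p}(u) = e_p(x·u + y·u⁻¹)` for `u ≠ 0` and `ψ_{x,y;p}(0) = 0`,
where `e_p(a) = exp(2πi·a/p)`. -/
noncomputable def psi (p : ℕ) (x y u : ZMod p) : ℂ :=
  if u = 0 then 0
  else Complex.exp (2 * Real.pi * Complex.I * ((x * u + y * u⁻¹).val : ℂ) / (p : ℂ))

section
open Polynomial

/-- Monic polynomials of degree `n` over `ZMod p`. -/
noncomputable def monicsOfDegree (p : ℕ) [Fact p.Prime] (n : ℕ) : Finset (ZMod p)[X] :=
  open Classical in
  (Finset.univ : Finset (Fin n → ZMod p)).image fun a => X ^ n + ∑ i : Fin n, C (a i) * X ^ (i : ℕ)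

/-- The completely multiplicative function `g ↦ e_p(-∑ c t * g'(t) / g(t))`, equal to `0` when `g`
vanishes somewhere on `T`. -/
noncomputable def logDerivChar (p : ℕ) [Fact p.Prime] (T : Finset (ZMod p)) (c : ZMod p → ZMod p)
    (g : (ZMod p)[X]) : ℂ :=
  open Classical in
  if ∃ t ∈ T, g.eval t = 0 then 0
  else ZMod.stdAddChar (-∑ t ∈ T, c t * (g.derivative.eval t / g.eval t))

section
variable {p : ℕ} [Fact p.Prime] {T : Finset (ZMod p)} {c : ZMod p → ZMod p}

lemma mem_monicsOfDegree {n : ℕ} {g : (ZMod p)[X]} :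
    g ∈ monicsOfDegree p n ↔ g.Monic ∧ g.natDegree = n := by
  classical
  unfold monicsOfDegree
  simp only [Finset.mem_image, Finset.mem_univ, true_and]
  constructor
  · rintro ⟨a, rfl⟩
    have hd : (∑ i : Fin n, C (a i) * X ^ (i : ℕ)).degree < (n : WithBot ℕ) := degree_sum_fin_lt a
    exact ⟨monic_X_pow_add hd, by
      rw [natDegree_add_eq_left_of_degree_lt, natDegree_X_pow]
      rwa [degree_X_pow]⟩
  · rintro ⟨hm, hn⟩
    refine ⟨fun i => g.coeff i, ?_⟩
    conv_rhs => rw [hm.as_sum]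
    rw [hn, Fin.sum_univ_eq_sum_range (fun i => C (g.coeff i) * X ^ i)]

lemma logDerivChar_mul (g h : (ZMod p)[X]) :
    logDerivChar p T c (g * h) = logDerivChar p T c g * logDerivChar p T c h := by
  classical
  unfold logDerivChar
  by_cases hg : ∃ t ∈ T, g.eval t = 0
  · have : ∃ t ∈ T, (g * h).eval t = 0 := by
      obtain ⟨t, ht, h0⟩ := hg
      exact ⟨t, ht, by simp [h0]⟩
    simp only [if_pos hg, if_pos this, zero_mul]
  by_cases hh : ∃ t ∈ T, h.eval t = 0
  · have : ∃ t ∈ T, (g * h).eval t = 0 := by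
      obtain ⟨t, ht, h0⟩ := hh
      exact ⟨t, ht, by simp [h0]⟩
    simp only [if_pos hh, if_pos this, mul_zero]
  have : ¬ ∃ t ∈ T, (g * h).eval t = 0 := by
    push Not at hg hh ⊢
    intro t ht
    simp [hg t ht, hh t ht]
  rw [if_neg hg, if_neg hh, if_neg this, ← AddChar.map_add_eq_mul, ← neg_add,
    ← Finset.sum_add_distrib]
  congr 2
  refine Finset.sum_congr rfl fun t ht => ?_
  push Not at hg hh
  have h1 := hg t ht
  have h2 := hh t ht
  simp only [derivative_mul, eval_add, eval_mul]
  field_simp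

@[simp] lemma logDerivChar_one : logDerivChar p T c 1 = 1 := by
  simp [logDerivChar]

lemma logDerivChar_pow (g : (ZMod p)[X]) (n : ℕ) :
    logDerivChar p T c (g ^ n) = logDerivChar p T c g ^ n := by
  induction n with
  | zero => simp
  | succ n ih => rw [pow_succ, pow_succ, logDerivChar_mul, ih]

variable (T c) in
/-- The coefficients of the `L`-function of `logDerivChar`. -/
noncomputable def lCoeff (n : ℕ) : ℂ := ∑ g ∈ monicsOfDegree p n, logDerivChar p T c g

variable (T c) in
/-- The sum of `d * χ(P) ^ (n / d)` over monic irreducible `P` of degree `d ∣ n`. -/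
noncomputable def primePowerSum (n : ℕ) : ℂ :=
  open Classical in
  ∑ d ∈ n.divisors, ∑ P ∈ monicsOfDegree p d with Irreducible P, d * logDerivChar p T c P ^ (n / d)

lemma lCoeff_zero : lCoeff T c 0 = 1 := by
  have : monicsOfDegree p 0 = {1} := by
    ext g
    rw [mem_monicsOfDegree, Finset.mem_singleton]
    exact ⟨fun h => h.1.natDegree_eq_zero.mp h.2, fun h => by simp [h]⟩
  simp [lCoeff, this]

lemma lCoeff_eq_zero {t₀ : ZMod p} (ht₀ : t₀ ∈ T) (hc : c t₀ ≠ 0) {n : ℕ} (hn : 2 * T.card ≤ n) :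
    lCoeff T c n = 0 := by
  classical
  set M : (ZMod p)[X] := (X - C t₀) * ∏ t ∈ T.erase t₀, (X - C t) ^ 2 with hM
  have hMm : M.Monic := (monic_X_sub_C _).mul
    (monic_prod_of_monic _ _ fun t _ => (monic_X_sub_C t).pow 2)
  have hMdeg : M.natDegree < n := by
    have h1 : (∏ t ∈ T.erase t₀, (X - C t) ^ 2 : (ZMod p)[X]).natDegree
        = 2 * (T.erase t₀).card := by
      rw [natDegree_prod_of_monic _ _ fun t _ => (monic_X_sub_C t).pow 2]
      simp [mul_comm]
    have h2 : M.natDegree = 1 + 2 * (T.erase t₀).card := by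
      rw [hM, (monic_X_sub_C t₀).natDegree_mul
        (monic_prod_of_monic _ _ fun t _ => (monic_X_sub_C t).pow 2), h1, natDegree_X_sub_C]
    rw [Finset.card_erase_of_mem ht₀] at h2
    have := Finset.card_pos.mpr ⟨t₀, ht₀⟩
    omega
  have hMe : ∀ t ∈ T, M.eval t = 0 := by
    intro t ht
    by_cases h : t = t₀
    · simp [hM, h]
    · simp only [hM, eval_mul, eval_prod]
      rw [Finset.prod_eq_zero (Finset.mem_erase.mpr ⟨h, ht⟩) (by simp), mul_zero]
  have hMd : ∀ t ∈ T, t ≠ t₀ → M.derivative.eval t = 0 := by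
    intro t ht h
    have : (X - C t) ^ 2 ∣ M :=
      (Finset.dvd_prod_of_mem (fun t => (X - C t) ^ 2 : ZMod p → (ZMod p)[X])
        (Finset.mem_erase.mpr ⟨h, ht⟩)).trans (dvd_mul_left _ _)
    obtain ⟨w, hw⟩ := this
    rw [hw]
    simp [derivative_mul, derivative_pow]
  have hMd0 : M.derivative.eval t₀ ≠ 0 := by
    simp only [hM, derivative_mul, eval_add, eval_mul, derivative_sub, derivative_X, derivative_C]
    simp only [sub_zero, eval_one, one_mul, eval_sub, eval_X, eval_C, sub_self, zero_mul, add_zero,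
      eval_prod]
    refine Finset.prod_ne_zero_iff.mpr fun t ht => ?_
    have := Finset.ne_of_mem_erase ht
    simpa [sub_eq_zero] using this.symm
  have key : ∀ g : (ZMod p)[X], ∑ b : ZMod p, logDerivChar p T c (g + C b * M) = 0 := by
    intro g
    by_cases hg : ∃ t ∈ T, g.eval t = 0
    · refine Finset.sum_eq_zero fun b _ => ?_
      obtain ⟨t, ht, h0⟩ := hg
      exact if_pos ⟨t, ht, by simp [h0, hMe t ht]⟩
    have hg' : ∀ b, ¬ ∃ t ∈ T, (g + C b * M).eval t = 0 := by
      push Not at hg ⊢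
      intro b t ht
      simpa [hMe t ht] using hg t ht
    push Not at hg
    set u : ZMod p := -(c t₀ * (M.derivative.eval t₀ / g.eval t₀)) with hu
    have hu0 : u ≠ 0 := neg_ne_zero.mpr (mul_ne_zero hc (div_ne_zero hMd0 (hg t₀ ht₀)))
    have : ∀ b, logDerivChar p T c (g + C b * M) =
        ZMod.stdAddChar (-∑ t ∈ T, c t * (g.derivative.eval t / g.eval t)) *
          ZMod.stdAddChar (b * u) := by
      intro b
      rw [logDerivChar, if_neg (hg' b), ← AddChar.map_add_eq_mul]
      congr 1
      rw [← Finset.add_sum_erase _ _ ht₀, ← Finset.add_sum_erase T (fun t => c t *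
        (g.derivative.eval t / g.eval t)) ht₀]
      have h3 : ∑ x ∈ T.erase t₀, c x * (eval x (derivative (g + C b * M)) / eval x (g + C b * M))
          = ∑ x ∈ T.erase t₀, c x * (eval x (derivative g) / eval x g) := by
        refine Finset.sum_congr rfl fun t ht => ?_
        have h1 := Finset.mem_of_mem_erase ht
        simp [hMe t h1, hMd t h1 (Finset.ne_of_mem_erase ht)]
      rw [h3]
      simp only [eval_add, derivative_add, derivative_mul, derivative_C, eval_mul, hMe t₀ ht₀,
        eval_C, hu, zero_mul, zero_add, mul_zero, add_zero]
      ring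
    simp_rw [this, ← Finset.mul_sum]
    rw [AddChar.sum_mulShift _ (ZMod.isPrimitive_stdAddChar p), if_neg hu0]
    simp
  have hshift : ∀ b : ZMod p, ∑ g ∈ monicsOfDegree p n, logDerivChar p T c (g + C b * M)
      = lCoeff T c n := by
    intro b
    have hmem : ∀ (b : ZMod p) (g : (ZMod p)[X]), g ∈ monicsOfDegree p n →
        g + C b * M ∈ monicsOfDegree p n := by
      intro b g hg
      rw [mem_monicsOfDegree] at hg ⊢
      have hlt : (C b * M).degree < g.degree := by
        rw [degree_eq_natDegree hg.1.ne_zero, hg.2]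
        have hCb : (C b * M).degree ≤ M.degree := by
          rw [← smul_eq_C_mul]
          exact degree_smul_le b M
        exact hCb.trans_lt ((natDegree_lt_iff_degree_lt hMm.ne_zero).mp hMdeg)
      exact ⟨hg.1.add_of_left hlt, by rw [natDegree_add_eq_left_of_degree_lt hlt, hg.2]⟩
    refine Finset.sum_bij' (fun g _ => g + C b * M) (fun g _ => g + C (-b) * M)
      (fun g hg => hmem b g hg) (fun g hg => hmem (-b) g hg) ?_ ?_ ?_
    · intro g _; simp
    · intro g _; simp
    · intro g _; rfl
  have : (p : ℂ) * lCoeff T c n = 0 := by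
    calc (p : ℂ) * lCoeff T c n = ∑ b : ZMod p, lCoeff T c n := by simp [ZMod.card]
      _ = ∑ b : ZMod p, ∑ g ∈ monicsOfDegree p n, logDerivChar p T c (g + C b * M) := by
        simp_rw [hshift]
      _ = 0 := by rw [Finset.sum_comm]; simp [key]
  have hp : (p : ℂ) ≠ 0 := by exact_mod_cast (Fact.out : p.Prime).ne_zero
  exact (mul_eq_zero.mp this).resolve_left hp

end

section
variable {p : ℕ} [Fact p.Prime] {T : Finset (ZMod p)} {c : ZMod p → ZMod p}

open Classical in
lemma sum_count_mul_eq_natDegree {n : ℕ} {g : (ZMod p)[X]} (hg : g ∈ monicsOfDegree p n) :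
    ∑ d ∈ Finset.Icc 1 n, ∑ P ∈ monicsOfDegree p d with Irreducible P,
      (UniqueFactorizationMonoid.normalizedFactors g).count P * d = n := by
  rw [mem_monicsOfDegree] at hg
  obtain ⟨hm, hn⟩ := hg
  set s := UniqueFactorizationMonoid.normalizedFactors g with hs
  have hprod : s.prod = g := by
    rw [hs, UniqueFactorizationMonoid.prod_normalizedFactors_eq, hm.normalize_eq_self]
    exact hm.ne_zero
  have hirr : ∀ P ∈ s, Irreducible P := fun P hP =>
    UniqueFactorizationMonoid.irreducible_of_normalized_factor P hP
  have hmon : ∀ P ∈ s, P.Monic := fun P hP => by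
    rw [← normalize_eq_self_iff_monic (hirr P hP).ne_zero]
    exact UniqueFactorizationMonoid.normalize_normalized_factor P hP
  have hdeg : ∑ P ∈ s.toFinset, s.count P * P.natDegree = n := by
    rw [← hn]
    conv_rhs => rw [← hprod]
    rw [natDegree_multiset_prod_of_monic _ hmon, Finset.sum_multiset_map_count]
    simp
  have hdvd : ∀ P ∈ s, P.natDegree ≤ n := fun P hP => hn ▸
    natDegree_le_of_dvd (UniqueFactorizationMonoid.dvd_of_mem_normalizedFactors hP) hm.ne_zero
  rw [Finset.sum_sigma']
  refine Eq.trans (Finset.sum_of_injOn (fun P => ⟨P.natDegree, P⟩) ?_ ?_ ?_ ?_).symm hdeg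
  · intro P _ Q _ h
    simpa using congrArg (fun x => x.2) h
  · intro P hP
    have hP' : P ∈ s := Multiset.mem_toFinset.mp hP
    simp only [Finset.coe_sigma, Set.mem_sigma_iff, Finset.mem_coe, Finset.mem_Icc,
      Finset.mem_filter, mem_monicsOfDegree]
    exact ⟨⟨(hirr P hP').natDegree_pos, hdvd P hP'⟩, ⟨hmon P hP', trivial⟩, hirr P hP'⟩
  · rintro ⟨d, P⟩ h hnot
    simp only [Finset.mem_sigma, Finset.mem_filter, mem_monicsOfDegree] at h
    have : P ∉ s := fun hP => hnot ⟨P, by simpa using hP, by simp [h.2.1.2]⟩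
    simp [Multiset.count_eq_zero_of_notMem this]
  · intro P _
    rfl

open Classical in
lemma card_pow_dvd_eq_count {n d : ℕ} {g P : (ZMod p)[X]} (hg : g ∈ monicsOfDegree p n)
    (hP : P ∈ monicsOfDegree p d) (hirr : Irreducible P) :
    ((Finset.Icc 1 n).filter fun k => d ∣ k ∧ P ^ (k / d) ∣ g).card
      = (UniqueFactorizationMonoid.normalizedFactors g).count P := by
  rw [mem_monicsOfDegree] at hg hP
  have hd : 0 < d := hP.2 ▸ hirr.natDegree_pos
  have hiff : ∀ j, P ^ j ∣ g ↔ j ≤ (UniqueFactorizationMonoid.normalizedFactors g).count P := by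
    intro j
    rw [pow_dvd_iff_le_emultiplicity,
      UniqueFactorizationMonoid.emultiplicity_eq_count_normalizedFactors hirr hg.1.ne_zero,
      hP.1.normalize_eq_self]
    exact Nat.cast_le
  set m := (UniqueFactorizationMonoid.normalizedFactors g).count P
  have hm : m * d ≤ n := by
    have := natDegree_le_of_dvd ((hiff m).mpr le_rfl) hg.1.ne_zero
    rwa [natDegree_pow, hP.2, hg.2] at this
  have : ((Finset.Icc 1 n).filter fun k => d ∣ k ∧ P ^ (k / d) ∣ g)
      = (Finset.Icc 1 m).image (· * d) := by
    ext k
    simp only [Finset.mem_filter, Finset.mem_Icc, Finset.mem_image, hiff]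
    constructor
    · rintro ⟨⟨h1, h2⟩, ⟨j, rfl⟩, h3⟩
      rw [Nat.mul_div_cancel_left _ hd] at h3
      exact ⟨j, ⟨Nat.pos_of_mul_pos_left h1, h3⟩, mul_comm _ _⟩
    · rintro ⟨j, ⟨h1, h2⟩, rfl⟩
      refine ⟨⟨Nat.mul_pos h1 hd, (Nat.mul_le_mul_right d h2).trans hm⟩, dvd_mul_left _ _, ?_⟩
      rwa [Nat.mul_div_cancel _ hd]
  rw [this, Finset.card_image_of_injective _ (mul_left_injective₀ hd.ne'), Nat.card_Icc]
  simp

open Classical in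
lemma sum_dvd_logDerivChar {n k : ℕ} {Q : (ZMod p)[X]} (hQ : Q ∈ monicsOfDegree p k)
    (hk : k ≤ n) :
    ∑ g ∈ monicsOfDegree p n with Q ∣ g, logDerivChar p T c g
      = logDerivChar p T c Q * lCoeff T c (n - k) := by
  rw [mem_monicsOfDegree] at hQ
  rw [lCoeff, Finset.mul_sum]
  symm
  refine Finset.sum_bij (fun h _ => Q * h) ?_ ?_ ?_ ?_
  · intro h hh
    rw [mem_monicsOfDegree] at hh
    rw [Finset.mem_filter, mem_monicsOfDegree]
    refine ⟨⟨hQ.1.mul hh.1, ?_⟩, dvd_mul_right _ _⟩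
    rw [hQ.1.natDegree_mul hh.1, hQ.2, hh.2]
    omega
  · intro a _ b _ h
    exact mul_left_cancel₀ hQ.1.ne_zero h
  · intro g hg
    rw [Finset.mem_filter, mem_monicsOfDegree] at hg
    obtain ⟨⟨hgm, hgn⟩, h, rfl⟩ := hg
    have hh : h.Monic := hQ.1.of_mul_monic_left hgm
    refine ⟨h, ?_, rfl⟩
    rw [mem_monicsOfDegree]
    rw [hQ.1.natDegree_mul hh, hQ.2] at hgn
    exact ⟨hh, by omega⟩
  · intro h _
    rw [logDerivChar_mul]

/-- The recurrence expressing `X * L' = (∑ S_k X ^ k) * L`. -/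
lemma mul_lCoeff_eq_sum (n : ℕ) :
    (n : ℂ) * lCoeff T c n
      = ∑ k ∈ Finset.Icc 1 n, primePowerSum T c k * lCoeff T c (n - k) := by
  classical
  have h1 : ∀ k ∈ Finset.Icc 1 n, primePowerSum T c k * lCoeff T c (n - k)
      = ∑ d ∈ (Finset.Icc 1 n).filter (· ∣ k),
          ∑ P ∈ monicsOfDegree p d with Irreducible P,
            ∑ g ∈ monicsOfDegree p n,
              if P ^ (k / d) ∣ g then (d : ℂ) * logDerivChar p T c g else 0 := by
    intro k hk
    rw [Finset.mem_Icc] at hk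
    have hdiv : (Finset.Icc 1 n).filter (· ∣ k) = k.divisors := by
      ext d
      simp only [Finset.mem_filter, Finset.mem_Icc, Nat.mem_divisors]
      constructor
      · rintro ⟨_, h⟩
        exact ⟨h, by omega⟩
      · rintro ⟨h, _⟩
        exact ⟨⟨Nat.pos_of_dvd_of_pos h hk.1, (Nat.le_of_dvd hk.1 h).trans hk.2⟩, h⟩
    rw [primePowerSum, hdiv, Finset.sum_mul]
    refine Finset.sum_congr rfl fun d hd => ?_
    rw [Finset.sum_mul]
    refine Finset.sum_congr rfl fun P hP => ?_
    rw [Finset.mem_filter] at hP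
    have hP2 := mem_monicsOfDegree.mp hP.1
    have hQ : P ^ (k / d) ∈ monicsOfDegree p k := by
      rw [mem_monicsOfDegree, natDegree_pow, hP2.2]
      exact ⟨hP2.1.pow _, Nat.div_mul_cancel (Nat.dvd_of_mem_divisors hd)⟩
    rw [← Finset.sum_filter, ← Finset.mul_sum, sum_dvd_logDerivChar hQ hk.2, logDerivChar_pow,
      mul_assoc]
  rw [Finset.sum_congr rfl h1]
  have h2 : ∑ k ∈ Finset.Icc 1 n, ∑ d ∈ (Finset.Icc 1 n).filter (· ∣ k),
          ∑ P ∈ monicsOfDegree p d with Irreducible P,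
            ∑ g ∈ monicsOfDegree p n,
              (if P ^ (k / d) ∣ g then (d : ℂ) * logDerivChar p T c g else 0)
      = ∑ g ∈ monicsOfDegree p n, ∑ d ∈ Finset.Icc 1 n,
          ∑ P ∈ monicsOfDegree p d with Irreducible P,
            ∑ k ∈ Finset.Icc 1 n,
              if d ∣ k ∧ P ^ (k / d) ∣ g then (d : ℂ) * logDerivChar p T c g else 0 := by
    simp_rw [Finset.sum_filter (· ∣ _)]
    rw [Finset.sum_comm]
    rw [Finset.sum_comm (s := monicsOfDegree p n)]
    refine Finset.sum_congr rfl fun d _ => ?_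
    rw [Finset.sum_comm (s := monicsOfDegree p n)]
    have h3 : ∀ k : ℕ, (if d ∣ k then
          ∑ P ∈ monicsOfDegree p d with Irreducible P,
            ∑ g ∈ monicsOfDegree p n,
              (if P ^ (k / d) ∣ g then (d : ℂ) * logDerivChar p T c g else 0) else 0)
        = ∑ P ∈ monicsOfDegree p d with Irreducible P,
            ∑ g ∈ monicsOfDegree p n,
              (if d ∣ k ∧ P ^ (k / d) ∣ g then (d : ℂ) * logDerivChar p T c g else 0) := by
      intro k
      split_ifs with h <;> simp [h]
    simp_rw [h3]
    rw [Finset.sum_comm]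
    refine Finset.sum_congr rfl fun P _ => ?_
    rw [Finset.sum_comm]
  rw [h2, lCoeff, Finset.mul_sum]
  refine Finset.sum_congr rfl fun g hg => ?_
  have h4 : ∀ d ∈ Finset.Icc 1 n, ∀ P ∈ (monicsOfDegree p d).filter Irreducible,
      (∑ k ∈ Finset.Icc 1 n,
        if d ∣ k ∧ P ^ (k / d) ∣ g then (d : ℂ) * logDerivChar p T c g else 0)
      = (((UniqueFactorizationMonoid.normalizedFactors g).count P * d : ℕ) : ℂ)
        * logDerivChar p T c g := by
    intro d _ P hP
    rw [Finset.mem_filter] at hP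
    rw [← Finset.sum_filter, Finset.sum_const, card_pow_dvd_eq_count hg hP.1 hP.2, nsmul_eq_mul]
    push_cast
    ring
  rw [Finset.sum_congr rfl fun d hd => Finset.sum_congr rfl (h4 d hd)]
  simp_rw [← Finset.sum_mul, ← Nat.cast_sum]
  rw [sum_count_mul_eq_natDegree hg]

end

section
variable {p : ℕ} [Fact p.Prime] {T : Finset (ZMod p)} {c : ZMod p → ZMod p}
  {K : Type*} [Field K] [Fintype K] [Algebra (ZMod p) K]

variable (p) in
lemma pow_card_pow_eq_self_iff (u : K) (k : ℕ) :
    u ^ p ^ k = u ↔ (minpoly (ZMod p) u).natDegree ∣ k := by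
  rw [(minpoly.irreducible (Algebra.IsIntegral.isIntegral u)
    ).natDegree_dvd_iff_dvd_X_pow_card_pow_sub_X, minpoly.dvd_iff]
  simp [sub_eq_zero]

variable (p) in
lemma minpoly_natDegree_dvd_finrank (u : K) :
    (minpoly (ZMod p) u).natDegree ∣ Module.finrank (ZMod p) K := by
  rw [← pow_card_pow_eq_self_iff]
  have := Module.card_eq_pow_finrank (K := ZMod p) (V := K)
  rw [ZMod.card] at this
  rw [← this, FiniteField.pow_card]

lemma splits_map_of_natDegree_dvd {P : (ZMod p)[X]} (hP : Irreducible P)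
    (hd : P.natDegree ∣ Module.finrank (ZMod p) K) :
    (P.map (algebraMap (ZMod p) K)).Splits ∧ (P.map (algebraMap (ZMod p) K)).roots.Nodup := by
  have hcard := Module.card_eq_pow_finrank (K := ZMod p) (V := K)
  rw [ZMod.card] at hcard
  rw [hP.natDegree_dvd_iff_dvd_X_pow_card_pow_sub_X] at hd
  have h1 := map_dvd (mapRingHom (algebraMap (ZMod p) K)) hd
  simp only [coe_mapRingHom, Polynomial.map_sub, Polynomial.map_pow, map_X, Nat.card_zmod,
    ← hcard] at h1
  have hne : (X ^ Fintype.card K - X : K[X]) ≠ 0 :=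
    FiniteField.X_pow_card_sub_X_ne_zero K Fintype.one_lt_card
  have hsp : (X ^ Fintype.card K - X : K[X]).Splits := by
    simpa using FiniteField.splits_X_pow_card_sub_X (K := K) p
  refine ⟨hsp.of_dvd hne h1, ?_⟩
  refine Multiset.nodup_of_le (roots.le_of_dvd hne h1) ?_
  rw [FiniteField.roots_X_pow_card_sub_X]
  exact Finset.univ.nodup

open Classical in
lemma card_filter_minpoly_eq {d : ℕ} {P : (ZMod p)[X]} (hP : P ∈ monicsOfDegree p d)
    (hirr : Irreducible P) (hd : d ∣ Module.finrank (ZMod p) K) :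
    (Finset.univ.filter fun u : K => minpoly (ZMod p) u = P).card = d := by
  rw [mem_monicsOfDegree] at hP
  obtain ⟨hs, hn⟩ := splits_map_of_natDegree_dvd (K := K) hirr (hP.2 ▸ hd)
  have : (Finset.univ.filter fun u : K => minpoly (ZMod p) u = P)
      = (P.map (algebraMap (ZMod p) K)).roots.toFinset := by
    ext u
    rw [Multiset.mem_toFinset, mem_roots (map_monic_ne_zero hP.1), Finset.mem_filter]
    simp only [Finset.mem_univ, true_and, IsRoot.def, eval_map_algebraMap]
    constructor
    · rintro rfl
      exact minpoly.aeval _ _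
    · intro h
      exact (minpoly.eq_of_irreducible_of_monic hirr h hP.1).symm
  rw [this, Multiset.toFinset_card_of_nodup hn, ← hs.natDegree_eq_card_roots, natDegree_map, hP.2]

lemma sum_roots_minpoly_eq {M : Type*} [AddCommMonoid M] (u : K) (φ : K → M) :
    ((((minpoly (ZMod p) u).map (algebraMap (ZMod p) K)).roots).map φ).sum
      = ∑ i ∈ Finset.range (minpoly (ZMod p) u).natDegree, φ (u ^ p ^ i) := by
  classical
  set P := minpoly (ZMod p) u with hP
  have hint : IsIntegral (ZMod p) u := Algebra.IsIntegral.isIntegral u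
  obtain ⟨hs, hn⟩ := splits_map_of_natDegree_dvd (K := K) (minpoly.irreducible hint)
    (minpoly_natDegree_dvd_finrank p u)
  have : CharP K p := charP_of_injective_algebraMap (algebraMap (ZMod p) K).injective p
  have hinj : Set.InjOn (fun i => u ^ p ^ i) (Finset.range P.natDegree : Set ℕ) := by
    have key : ∀ i j, i < j → j < P.natDegree → u ^ p ^ i ≠ u ^ p ^ j := by
      intro i j hij hj h
      have h1 : j = (j - i) + i := by omega
      rw [h1, pow_add, pow_mul] at h
      have h2 : u = u ^ p ^ (j - i) := by
        apply iterateFrobenius_inj K p i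
        simpa [iterateFrobenius_def] using h
      have := (pow_card_pow_eq_self_iff p u (j - i)).mp h2.symm
      have h3 := Nat.le_of_dvd (by omega) this
      rw [← hP] at h3
      omega
    intro i hi j hj h
    simp only [Finset.coe_range, Set.mem_Iio] at hi hj
    rcases lt_trichotomy i j with hij | hij | hij
    · exact absurd h (key i j hij hj)
    · exact hij
    · exact absurd h.symm (key j i hij hi)
  have himg : (Finset.range P.natDegree).image (fun i => u ^ p ^ i)
      = (P.map (algebraMap (ZMod p) K)).roots.toFinset := by
    refine Finset.eq_of_subset_of_card_le ?_ ?_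
    · intro z hz
      obtain ⟨i, hi, rfl⟩ := Finset.mem_image.mp hz
      clear hz hi
      rw [Multiset.mem_toFinset, mem_roots (map_monic_ne_zero (minpoly.monic hint)), IsRoot.def,
        eval_map_algebraMap]
      have := minpoly.aeval (ZMod p) u
      have h3 : aeval (u ^ p ^ i) P = (aeval u P) ^ p ^ i := by
        induction i with
        | zero => simp
        | succ i ih =>
          rw [pow_succ, pow_mul, pow_mul, ← ih, ← map_pow, ← ZMod.expand_card, expand_aeval]
      rw [h3, this, zero_pow (pow_ne_zero _ (Fact.out : p.Prime).ne_zero)]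
    · rw [Finset.card_image_of_injOn hinj, Multiset.toFinset_card_of_nodup hn,
        ← hs.natDegree_eq_card_roots, natDegree_map, Finset.card_range]
  rw [← Finset.sum_image (f := φ) hinj, himg, Finset.sum, Multiset.toFinset_val, hn.dedup]

lemma trace_inv_sub_eq (u : K) (t : ZMod p) (ht : u ≠ algebraMap (ZMod p) K t) :
    Algebra.trace (ZMod p) K ((u - algebraMap (ZMod p) K t)⁻¹)
      = -((Module.finrank (ZMod p) K / (minpoly (ZMod p) u).natDegree : ℕ) : ZMod p)
        * ((minpoly (ZMod p) u).derivative.eval t / (minpoly (ZMod p) u).eval t) := by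
  set P := minpoly (ZMod p) u with hP
  have hint : IsIntegral (ZMod p) u := Algebra.IsIntegral.isIntegral u
  have hirr := minpoly.irreducible hint
  have hdvd := minpoly_natDegree_dvd_finrank p u
  obtain ⟨hs, hn⟩ := splits_map_of_natDegree_dvd (K := K) hirr hdvd
  have : CharP K p := charP_of_injective_algebraMap (algebraMap (ZMod p) K).injective p
  apply (algebraMap (ZMod p) K).injective
  rw [FiniteField.algebraMap_trace_eq_sum_pow, Nat.card_zmod]
  have hPt : P.eval t ≠ 0 := by
    intro h
    have h1 : P = X - C t := by
      have hd : X - C t ∣ P := dvd_iff_isRoot.mpr h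
      exact (eq_of_monic_of_associated (monic_X_sub_C t) (minpoly.monic hint)
        ((irreducible_X_sub_C t).associated_of_dvd hirr hd)).symm
    have h2 := minpoly.aeval (ZMod p) u
    rw [← hP, h1] at h2
    simp [sub_eq_zero] at h2
    exact ht h2
  have hPt' : (P.map (algebraMap (ZMod p) K)).eval (algebraMap (ZMod p) K t) ≠ 0 := by
    rw [eval_map_algebraMap, aeval_algebraMap_apply]
    simpa using hPt
  have h1 := hs.eval_derivative_div_eval_of_ne_zero hPt'
  rw [derivative_map, eval_map_algebraMap, eval_map_algebraMap, aeval_algebraMap_apply,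
    aeval_algebraMap_apply] at h1
  simp only [coe_aeval_eq_eval] at h1
  rw [map_mul, map_neg, map_natCast, map_div₀, h1, sum_roots_minpoly_eq (p := p) u]
  have h2 : ∀ e : ℕ, ∑ i ∈ Finset.range (P.natDegree * e), (u - algebraMap (ZMod p) K t)⁻¹ ^ p ^ i
      = e * ∑ i ∈ Finset.range P.natDegree, (u - algebraMap (ZMod p) K t)⁻¹ ^ p ^ i := by
    intro e
    induction e with
    | zero => simp
    | succ e ih =>
      rw [Nat.mul_succ, Finset.sum_range_add, ih]
      have h3 : u ^ p ^ (P.natDegree * e) = u :=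
        (pow_card_pow_eq_self_iff p u _).mpr (dvd_mul_right _ _)
      have h4 : (u - algebraMap (ZMod p) K t)⁻¹ ^ p ^ (P.natDegree * e)
          = (u - algebraMap (ZMod p) K t)⁻¹ := by
        rw [inv_pow, sub_pow_char_pow, h3, ← map_pow, ZMod.pow_card_pow]
      simp_rw [pow_add p, pow_mul _ (p ^ (P.natDegree * e)), h4]
      push_cast
      ring
  have h5 := h2 (Module.finrank (ZMod p) K / P.natDegree)
  rw [Nat.mul_div_cancel' hdvd] at h5
  rw [h5, neg_mul, ← mul_neg, ← Finset.sum_neg_distrib]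
  congr 1
  refine Finset.sum_congr rfl fun i _ => ?_
  rw [inv_pow, sub_pow_char_pow, ← map_pow, ZMod.pow_card_pow, one_div, ← inv_neg, neg_sub]

open Classical in
lemma logDerivChar_minpoly_pow (u : K) :
    logDerivChar p T c (minpoly (ZMod p) u)
        ^ (Module.finrank (ZMod p) K / (minpoly (ZMod p) u).natDegree)
      = if ∃ t ∈ T, u = algebraMap (ZMod p) K t then 0 else
        ZMod.stdAddChar (∑ t ∈ T, c t *
          Algebra.trace (ZMod p) K ((u - algebraMap (ZMod p) K t)⁻¹)) := by
  have hint : IsIntegral (ZMod p) u := Algebra.IsIntegral.isIntegral u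
  have hdpos := minpoly.natDegree_pos hint
  have hiff : ∀ t, (minpoly (ZMod p) u).eval t = 0 ↔ u = algebraMap (ZMod p) K t := by
    intro t
    constructor
    · intro h
      by_contra ht
      have hd : X - C t ∣ minpoly (ZMod p) u := dvd_iff_isRoot.mpr h
      have h1 := (eq_of_monic_of_associated (monic_X_sub_C t) (minpoly.monic hint)
        ((irreducible_X_sub_C t).associated_of_dvd (minpoly.irreducible hint) hd)).symm
      have h2 := minpoly.aeval (ZMod p) u
      rw [h1] at h2
      simp [sub_eq_zero] at h2
      exact ht h2
    · rintro rfl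
      rw [minpoly.eq_X_sub_C]
      simp
  unfold logDerivChar
  simp_rw [hiff]
  split_ifs with h
  · rw [zero_pow]
    exact (Nat.div_pos (Nat.le_of_dvd Module.finrank_pos (minpoly_natDegree_dvd_finrank p u))
      hdpos).ne'
  · rw [← AddChar.map_nsmul_eq_pow]
    congr 1
    push Not at h
    rw [nsmul_eq_mul, mul_neg, Finset.mul_sum, ← Finset.sum_neg_distrib]
    refine Finset.sum_congr rfl fun t ht => ?_
    rw [trace_inv_sub_eq u t (h t ht)]
    ring

open Classical in
variable (T c K) in
lemma primePowerSum_eq_sum :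
    primePowerSum T c (Module.finrank (ZMod p) K)
      = ∑ u : K, if ∃ t ∈ T, u = algebraMap (ZMod p) K t then 0 else
        ZMod.stdAddChar (∑ t ∈ T, c t *
          Algebra.trace (ZMod p) K ((u - algebraMap (ZMod p) K t)⁻¹)) := by
  set n := Module.finrank (ZMod p) K with hn
  have hn0 : n ≠ 0 := Module.finrank_pos.ne'
  simp_rw [← logDerivChar_minpoly_pow]
  rw [primePowerSum]
  rw [← Finset.sum_fiberwise_of_maps_to (s := Finset.univ) (t := n.divisors)
    (g := fun u : K => (minpoly (ZMod p) u).natDegree)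
    (fun u _ => Nat.mem_divisors.mpr ⟨minpoly_natDegree_dvd_finrank p u, hn0⟩)]
  refine Finset.sum_congr rfl fun d hd => ?_
  rw [← Finset.sum_fiberwise_of_maps_to (t := (monicsOfDegree p d).filter Irreducible)
    (g := fun u : K => minpoly (ZMod p) u)]
  · refine Finset.sum_congr rfl fun P hP => ?_
    rw [Finset.mem_filter] at hP
    have h1 : ((Finset.univ.filter fun u : K => (minpoly (ZMod p) u).natDegree = d).filter
        fun u => minpoly (ZMod p) u = P) = Finset.univ.filter fun u => minpoly (ZMod p) u = P := by
      rw [Finset.filter_filter]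
      refine Finset.filter_congr fun u _ => ?_
      have := (mem_monicsOfDegree.mp hP.1).2
      constructor
      · exact fun h => h.2
      · rintro h
        exact ⟨by rw [h, this], h⟩
    rw [h1, Finset.sum_congr rfl (g := fun _ => logDerivChar p T c P ^ (n / d)), Finset.sum_const,
      card_filter_minpoly_eq hP.1 hP.2 (Nat.dvd_of_mem_divisors hd), nsmul_eq_mul]
    intro u hu
    rw [Finset.mem_filter] at hu
    rw [hu.2, (mem_monicsOfDegree.mp hP.1).2]
  · intro u hu
    have hint : IsIntegral (ZMod p) u := Algebra.IsIntegral.isIntegral u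
    rw [Finset.mem_filter] at hu ⊢
    exact ⟨mem_monicsOfDegree.mpr ⟨minpoly.monic hint, hu.2⟩, minpoly.irreducible hint⟩

end

section
variable {F : Type*} [Field F]

lemma eq_zero_of_sum_pow_mul_eq_zero {t₀ : F} {n : ℕ} {α : ℕ → F} {w : ℕ → F[X]}
    (hw : ∀ e, (w e).eval t₀ ≠ 0)
    (h : ∑ e ∈ Finset.range n, C (α e) * (X - C t₀) ^ e * w e = 0) : ∀ e < n, α e = 0 := by
  induction n generalizing α w with
  | zero => simp
  | succ n ih =>
    rw [Finset.sum_range_succ'] at h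
    have h1 := congrArg (eval t₀) h
    have h0 : α 0 = 0 := by
      simpa [eval_finsetSum, hw 0] using h1
    have h2 : (X - C t₀) * ∑ e ∈ Finset.range n, C (α (e + 1)) * (X - C t₀) ^ e * w (e + 1) = 0 := by
      rw [← h, h0, Finset.mul_sum]
      simp only [C_0, zero_mul, add_zero]
      exact Finset.sum_congr rfl fun e _ => by ring
    have h3 := ih (α := fun e => α (e + 1)) (w := fun e => w (e + 1)) (fun e => hw _)
      ((mul_eq_zero.mp h2).resolve_left (X_sub_C_ne_zero t₀))
    intro e he
    cases e with
    | zero => exact h0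
    | succ e => exact h3 e (by omega)

lemma exists_sum_smul_eq_zero {n n' : ℕ} (hn : n' < n) {g : ℕ → F[X]}
    (hg : ∀ e, (g e).degree < n') :
    ∃ α : ℕ → F, (∃ e < n, α e ≠ 0) ∧ ∑ e ∈ Finset.range n, C (α e) * g e = 0 := by
  have h1 : ¬ LinearIndependent F fun e : Fin n =>
      (⟨g e, mem_degreeLT.mpr (hg e)⟩ : degreeLT F n') := by
    intro h
    have := h.fintype_card_le_finrank
    rw [(degreeLTEquiv F n').finrank_eq] at this
    simp at this
    omega
  obtain ⟨α, hα, i, hi⟩ := Fintype.not_linearIndependent_iff.mp h1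
  refine ⟨fun e => if h : e < n then α ⟨e, h⟩ else 0, ⟨i, i.2, by simpa using hi⟩, ?_⟩
  have h2 := congrArg Subtype.val hα
  rw [Finset.sum_range]
  simpa [smul_eq_C_mul] using h2

end

section
variable {p : ℕ} [Fact p.Prime] {T : Finset (ZMod p)} {c : ZMod p → ZMod p}

variable (T) in
/-- The common denominator of `∑ c t / (X - t)`. -/
noncomputable def polePoly : (ZMod p)[X] := ∏ t ∈ T, (X - C t)

variable (T c) in
/-- The numerator of `∑ c t / (X - t)`. -/
noncomputable def poleNumerator : (ZMod p)[X] :=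
  ∑ t ∈ T, C (c t) * ∏ t' ∈ T.erase t, (X - C t')

variable (T c) in
/-- The numerator of `∑_{a ≤ k} R ^ (p ^ a)` with `R = ∑ c t / (X - t)`, over the denominator
`polePoly T ^ (p ^ k)`. -/
noncomputable def partialTracePoly (k : ℕ) : (ZMod p)[X] :=
  ∑ a ∈ Finset.range (k + 1), poleNumerator T c ^ p ^ a * polePoly T ^ (p ^ k - p ^ a)

lemma natDegree_polePoly : (polePoly T).natDegree = T.card := by
  simp [polePoly, natDegree_prod_of_monic _ (fun t : ZMod p => X - C t) fun t _ => monic_X_sub_C t]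

lemma natDegree_poleNumerator_le : (poleNumerator T c).natDegree ≤ T.card := by
  refine natDegree_sum_le_of_forall_le _ _ fun t _ => (natDegree_C_mul_le _ _).trans ?_
  rw [natDegree_prod_of_monic _ _ fun t _ => monic_X_sub_C t]
  simpa using Finset.card_erase_le

lemma natDegree_partialTracePoly_le (k : ℕ) :
    (partialTracePoly T c k).natDegree ≤ T.card * p ^ k := by
  refine natDegree_sum_le_of_forall_le _ _ fun a ha => natDegree_mul_le.trans ?_
  have h1 : p ^ a ≤ p ^ k := Nat.pow_le_pow_right (Fact.out : p.Prime).pos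
    (Nat.lt_succ_iff.mp (Finset.mem_range.mp ha))
  calc _ ≤ p ^ a * T.card + (p ^ k - p ^ a) * T.card := by
        gcongr
        · exact natDegree_pow_le.trans (Nat.mul_le_mul_left _ natDegree_poleNumerator_le)
        · exact natDegree_pow_le.trans (Nat.mul_le_mul_left _ natDegree_polePoly.le)
    _ = T.card * p ^ k := by rw [← add_mul, Nat.add_sub_cancel' h1, mul_comm]

lemma eval_polePoly_eq_zero {t₀ : ZMod p} (ht₀ : t₀ ∈ T) : (polePoly T).eval t₀ = 0 := by
  rw [polePoly, eval_prod]
  exact Finset.prod_eq_zero ht₀ (by simp)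

lemma eval_partialTracePoly_ne_zero {t₀ : ZMod p} (ht₀ : t₀ ∈ T) (hc : c t₀ ≠ 0) (k : ℕ) :
    (partialTracePoly T c k).eval t₀ ≠ 0 := by
  have hp := (Fact.out : p.Prime)
  have h1 : (poleNumerator T c).eval t₀ ≠ 0 := by
    rw [poleNumerator, eval_finsetSum, Finset.sum_eq_single_of_mem t₀ ht₀]
    · rw [eval_mul, eval_C, eval_prod]
      refine mul_ne_zero hc (Finset.prod_ne_zero_iff.mpr fun t ht => ?_)
      have := (Finset.ne_of_mem_erase ht).symm
      simpa [sub_eq_zero] using this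
    · intro t _ htt
      rw [eval_mul, eval_prod, Finset.prod_eq_zero (Finset.mem_erase.mpr ⟨htt.symm, ht₀⟩) (by simp),
        mul_zero]
  rw [partialTracePoly, eval_finsetSum, Finset.sum_eq_single_of_mem k (by simp)]
  · simpa using h1
  · intro a ha hak
    have : p ^ a < p ^ k := Nat.pow_lt_pow_right hp.one_lt (by
      have := Finset.mem_range.mp ha
      omega)
    rw [eval_mul, eval_pow (n := p ^ k - p ^ a), eval_polePoly_eq_zero ht₀, zero_pow (by omega),
      mul_zero]

variable {K : Type*} [Field K] [Algebra (ZMod p) K]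

lemma aeval_polePoly_ne_zero {u : K} (hu : ∀ t ∈ T, u ≠ algebraMap (ZMod p) K t) :
    aeval u (polePoly T) ≠ 0 := by
  rw [polePoly, map_prod]
  exact Finset.prod_ne_zero_iff.mpr fun t ht => by simpa [sub_eq_zero] using hu t ht

lemma aeval_poleNumerator {u : K} (hu : ∀ t ∈ T, u ≠ algebraMap (ZMod p) K t) :
    aeval u (poleNumerator T c)
      = (∑ t ∈ T, algebraMap (ZMod p) K (c t) * (u - algebraMap (ZMod p) K t)⁻¹)
        * aeval u (polePoly T) := by
  rw [poleNumerator, map_sum, Finset.sum_mul]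
  refine Finset.sum_congr rfl fun t ht => ?_
  have h : u - algebraMap (ZMod p) K t ≠ 0 := sub_ne_zero.mpr (hu t ht)
  rw [polePoly, ← Finset.mul_prod_erase _ _ ht, map_mul, map_mul]
  simp only [aeval_C, map_sub, aeval_X]
  field_simp

lemma aeval_partialTracePoly {u : K} (hu : ∀ t ∈ T, u ≠ algebraMap (ZMod p) K t) (k : ℕ) :
    aeval u (partialTracePoly T c k)
      = (∑ a ∈ Finset.range (k + 1),
          (∑ t ∈ T, algebraMap (ZMod p) K (c t) * (u - algebraMap (ZMod p) K t)⁻¹) ^ p ^ a)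
        * aeval u (polePoly T) ^ p ^ k := by
  rw [partialTracePoly, map_sum, Finset.sum_mul]
  refine Finset.sum_congr rfl fun a ha => ?_
  have h1 : p ^ a ≤ p ^ k := Nat.pow_le_pow_right (Fact.out : p.Prime).pos
    (Nat.lt_succ_iff.mp (Finset.mem_range.mp ha))
  rw [map_mul, map_pow, map_pow, aeval_poleNumerator hu, mul_pow, mul_assoc, ← pow_add,
    Nat.add_sub_cancel' h1]


open Classical in
lemma card_trace_eq_le [Fintype K] {t₀ : ZMod p} (ht₀ : t₀ ∈ T) (hc : c t₀ ≠ 0) {k : ℕ}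
    (hk : T.card + 1 ≤ p ^ k) (hK : Module.finrank (ZMod p) K = 2 * (k + 1)) (v : ZMod p) :
    (Finset.univ.filter fun u : K => (∀ t ∈ T, u ≠ algebraMap (ZMod p) K t) ∧
      Algebra.trace (ZMod p) K (∑ t ∈ T, algebraMap (ZMod p) K (c t) *
        (u - algebraMap (ZMod p) K t)⁻¹) = v).card
      ≤ p ^ (2 * k + 1) + (2 * T.card + 1) * p ^ (k + 1) := by
  have hp := (Fact.out : p.Prime)
  have : CharP K p := charP_of_injective_algebraMap (algebraMap (ZMod p) K).injective p
  set s := T.card with hs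
  obtain ⟨Q, hQ⟩ : ∃ Q, Q = p ^ k := ⟨_, rfl⟩
  obtain ⟨P, hP⟩ : ∃ P, P = p ^ (k + 1) := ⟨_, rfl⟩
  have hPQ : P = Q * p := by rw [hP, hQ, pow_succ]
  have hQ0 : 0 < Q := hQ ▸ pow_pos hp.pos k
  have hP0 : 0 < P := hP ▸ pow_pos hp.pos _
  rw [← hQ] at hk
  set D := polePoly T with hD
  set H := partialTracePoly T c k with hH
  set I := Q + s + 1 with hI
  have hb : ∀ e, e % P / Q ≤ p - 1 := fun e => by
    have : e % P / Q < p := Nat.div_lt_of_lt_mul (hPQ ▸ Nat.mod_lt _ hP0)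
    omega
  have hj : ∀ e, e % P % Q < Q := fun e => Nat.mod_lt _ hQ0
  let E : ℕ → (ZMod p)[X] := fun e => (X - C t₀) ^ (e % P % Q + e / P * P) *
    H ^ (p - 1 - e % P / Q) * D ^ (Q * (e % P / Q))
  let Φ : ℕ → (ZMod p)[X] := fun e => (X - C t₀) ^ (e % P % Q * P + e / P) *
    (C v * D ^ Q - H) ^ (p - 1 - e % P / Q) * D ^ (Q * (e % P / Q))
  have hHdeg : H.natDegree ≤ s * Q := hQ ▸ natDegree_partialTracePoly_le k
  have hDdeg : D.natDegree = s := natDegree_polePoly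
  have hdeg : ∀ (e : ℕ) (n : ℕ) (A : (ZMod p)[X]), A.natDegree ≤ s * Q →
      ((X - C t₀) ^ n * A ^ (p - 1 - e % P / Q) * D ^ (Q * (e % P / Q))).natDegree
        ≤ n + (p - 1) * (s * Q) := by
    intro e n A hA
    calc _ ≤ n * 1 + (p - 1 - e % P / Q) * (s * Q) + Q * (e % P / Q) * s := by
          refine natDegree_mul_le.trans (add_le_add (natDegree_mul_le.trans (add_le_add ?_ ?_)) ?_)
          · exact natDegree_pow_le.trans (by rw [natDegree_X_sub_C])
          · exact natDegree_pow_le.trans (Nat.mul_le_mul_left _ hA)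
          · exact natDegree_pow_le.trans (by rw [hDdeg])
      _ = n + ((p - 1 - e % P / Q) + e % P / Q) * (s * Q) := by ring
      _ = _ := by rw [Nat.sub_add_cancel (hb e)]
  have hp2 := hp.two_le
  have hsp : (p - 1) * (s * Q) + s * Q = s * P := by
    rw [hPQ]
    obtain ⟨b, rfl⟩ : ∃ b, p = b + 1 := ⟨p - 1, by omega⟩
    simp only [Nat.add_sub_cancel]
    ring
  have hP2 : 2 * Q ≤ P := by
    rw [hPQ, mul_comm]
    exact Nat.mul_le_mul_left _ hp2
  have hn' : (Q - 1) * P + (I - 1) + (p - 1) * (s * Q) + 1 < I * P := by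
    obtain ⟨a, rfl⟩ : ∃ a, Q = a + 1 := ⟨Q - 1, by omega⟩
    simp only [hI, Nat.add_sub_cancel]
    nlinarith
  have hΦdeg : ∀ e < I * P, (Φ e).natDegree ≤ (Q - 1) * P + (I - 1) + (p - 1) * (s * Q) := by
    intro e he
    refine (hdeg e _ _ ?_).trans ?_
    · refine (natDegree_sub_le _ _).trans (max_le ((natDegree_C_mul_le _ _).trans ?_) hHdeg)
      exact natDegree_pow_le.trans (by rw [hDdeg, mul_comm])
    · gcongr
      · exact Nat.le_sub_one_of_lt (hj e)
      · exact Nat.le_sub_one_of_lt (Nat.div_lt_of_lt_mul (by rwa [mul_comm]))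
  obtain ⟨α, ⟨e₀, he₀, hα⟩, hsum⟩ := exists_sum_smul_eq_zero
    (g := fun e => if e < I * P then Φ e else 0) hn' (fun e => by
      split_ifs with he
      · exact degree_le_natDegree.trans_lt (by
          exact_mod_cast Nat.lt_succ_of_le (hΦdeg e he))
      · rw [degree_zero]
        exact bot_lt_iff_ne_bot.mpr (WithBot.natCast_ne_bot _))
  replace hsum : ∑ e ∈ Finset.range (I * P), C (α e) * Φ e = 0 := by
    rw [← hsum]
    exact Finset.sum_congr rfl fun e he => by rw [if_pos (Finset.mem_range.mp he)]
  set G := ∑ e ∈ Finset.range (I * P), C (α e) * E e with hG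
  have hG0 : G ≠ 0 := by
    intro h0
    refine hα (eq_zero_of_sum_pow_mul_eq_zero (t₀ := t₀) (w := fun e => H ^ (p - 1 - e % P / Q) *
      (∏ t ∈ T.erase t₀, (X - C t)) ^ (Q * (e % P / Q))) ?_ ?_ e₀ he₀)
    · intro e
      rw [eval_mul, eval_pow, eval_pow, eval_prod]
      refine mul_ne_zero (pow_ne_zero _ (eval_partialTracePoly_ne_zero ht₀ hc k))
        (pow_ne_zero _ (Finset.prod_ne_zero_iff.mpr fun t ht => ?_))
      have := (Finset.ne_of_mem_erase ht).symm
      simpa [sub_eq_zero] using this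
    · rw [← h0, hG]
      refine Finset.sum_congr rfl fun e _ => ?_
      have h1 : (X - C t₀) ^ e =
          (X - C t₀) ^ (e % P % Q + e / P * P) * (X - C t₀) ^ (Q * (e % P / Q)) := by
        rw [← pow_add]
        congr 1
        have h2 := Nat.div_add_mod e P
        have h3 := Nat.div_add_mod (e % P) Q
        nlinarith
      have h2 : D = (X - C t₀) * ∏ t ∈ T.erase t₀, (X - C t) := by
        rw [hD, polePoly, Finset.mul_prod_erase _ (fun t => X - C t) ht₀]
      simp only [E]
      rw [h2, h1, mul_pow (X - C t₀)]
      ring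
  have hGdeg : G.natDegree ≤ p ^ (2 * k + 1) + (2 * s + 1) * p ^ (k + 1) := by
    have h1 : p ^ (2 * k + 1) = Q * P := by rw [hQ, hP, ← pow_add]; congr 1; ring
    rw [h1, ← hP]
    refine natDegree_sum_le_of_forall_le _ _ fun e he => (natDegree_C_mul_le _ _).trans ?_
    refine (hdeg e _ _ hHdeg).trans ?_
    have h2 : e / P ≤ Q + s := Nat.le_of_lt_succ (Nat.div_lt_of_lt_mul (by
      rw [mul_comm]
      exact Finset.mem_range.mp he))
    have h3 := Nat.mul_le_mul_right P h2
    have h4 := hj e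
    nlinarith
  have hGK : G.map (algebraMap (ZMod p) K) ≠ 0 := by
    rwa [Ne, Polynomial.map_eq_zero_iff (algebraMap (ZMod p) K).injective]
  refine le_trans ?_ ((card_roots' (G.map (algebraMap (ZMod p) K))).trans
    (natDegree_map_le.trans hGdeg))
  refine le_trans (Finset.card_le_card (t := (G.map (algebraMap (ZMod p) K)).roots.toFinset) ?_)
    (Multiset.toFinset_card_le _)
  intro u hu
  obtain ⟨hu, htr⟩ := (Finset.mem_filter.mp hu).2
  rw [Multiset.mem_toFinset, mem_roots hGK, IsRoot.def, eval_map_algebraMap]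
  set R := ∑ t ∈ T, algebraMap (ZMod p) K (c t) * (u - algebraMap (ZMod p) K t)⁻¹ with hR
  set h := ∑ a ∈ Finset.range (k + 1), R ^ p ^ a with hh
  have hHu : aeval u H = h * aeval u D ^ Q := hQ ▸ aeval_partialTracePoly hu k
  have hhP : h ^ P = algebraMap (ZMod p) K v - h := by
    rw [← htr, FiniteField.algebraMap_trace_eq_sum_pow, Nat.card_zmod, hK, two_mul,
      Finset.sum_range_add, hP, hh, sum_pow_char_pow, add_sub_cancel_left]
    exact Finset.sum_congr rfl fun a _ => by rw [← pow_mul, ← pow_add, add_comm]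
  have hd0 : aeval u D ≠ 0 := aeval_polePoly_ne_zero hu
  have hcard : Fintype.card K = P * P := by
    rw [Module.card_eq_pow_finrank (K := ZMod p), hK, ZMod.card, hP, ← pow_add, two_mul]
  have hx : (u - algebraMap (ZMod p) K t₀) ^ (P * P) = u - algebraMap (ZMod p) K t₀ := by
    rw [← hcard, FiniteField.pow_card]
  have key : ∀ e, aeval u (C (α e) * E e) ^ P * aeval u D ^ (Q * (p - 1))
      = aeval u D ^ (P * Q * (p - 1)) * aeval u (C (α e) * Φ e) := by
    intro e
    have hα' : algebraMap (ZMod p) K (α e) ^ P = algebraMap (ZMod p) K (α e) := by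
      rw [← map_pow, hP, ZMod.pow_card_pow]
    have hpe : p - 1 = (p - 1 - e % P / Q) + e % P / Q := (Nat.sub_add_cancel (hb e)).symm
    simp only [E, Φ, map_mul, map_pow, map_sub, aeval_X, aeval_C, hHu]
    generalize e % P / Q = b at *
    generalize p - 1 - b = a at *
    rw [hpe]
    generalize aeval u D = d at *
    generalize u - algebraMap (ZMod p) K t₀ = x at *
    have h1 : algebraMap (ZMod p) K v * d ^ Q - h * d ^ Q = h ^ P * d ^ Q := by
      rw [hhP]
      ring
    rw [h1]
    generalize e % P % Q = j at *
    generalize e / P = i at *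
    have h2 : x ^ (P * (i * P)) = x ^ i := by
      rw [show P * (i * P) = (P * P) * i by ring, pow_mul, hx]
    calc _ = algebraMap (ZMod p) K (α e) ^ P * x ^ (j * P) * x ^ (P * (i * P)) * h ^ (P * a) *
          d ^ (P * Q * (a + b) + Q * (a + b)) := by ring
      _ = algebraMap (ZMod p) K (α e) * x ^ (j * P) * x ^ i * h ^ (P * a) *
          d ^ (P * Q * (a + b) + Q * (a + b)) := by rw [hα', h2]
      _ = _ := by ring
  have h3 : aeval u G ^ P * aeval u D ^ (Q * (p - 1)) = 0 := by
    have h4 : aeval u G ^ P = ∑ e ∈ Finset.range (I * P), aeval u (C (α e) * E e) ^ P := by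
      rw [hG, map_sum, hP, sum_pow_char_pow]
    rw [h4, Finset.sum_mul, Finset.sum_congr rfl fun e _ => key e, ← Finset.mul_sum, ← map_sum,
      hsum, map_zero, mul_zero]
  exact eq_zero_of_pow_eq_zero ((mul_eq_zero.mp h3).resolve_right (pow_ne_zero _ hd0))

end

lemma exists_eq_neg_sum_pow {d : ℕ} {A S : ℕ → ℂ} (hA0 : A 0 = 1) (hA : ∀ n : ℕ, d < n → A n = 0)
    (hS : ∀ n : ℕ, (n : ℂ) * A n = ∑ k ∈ Finset.Icc 1 n, S k * A (n - k)) :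
    ∃ z : Fin d → ℂ, ∀ n : ℕ, 1 ≤ n → S n = -∑ i, z i ^ n := by
  set R : ℂ[X] := X ^ d + ∑ j : Fin d, C (A (d - j)) * X ^ (j : ℕ) with hR
  have hlt : (∑ j : Fin d, C (A (d - j)) * X ^ (j : ℕ)).degree < (d : WithBot ℕ) :=
    degree_sum_fin_lt fun j : Fin d => A (d - j)
  have hmon : R.Monic := monic_X_pow_add hlt
  have hdeg : R.natDegree = d := by
    rw [hR, natDegree_add_eq_left_of_degree_lt, natDegree_X_pow]
    rwa [degree_X_pow]
  have hcoeff : ∀ n ≤ d, R.coeff (d - n) = A n := by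
    intro n hn
    rw [hR, Fin.sum_univ_eq_sum_range (fun j => C (A (d - j)) * X ^ j)]
    simp only [coeff_add, coeff_X_pow, finsetSum_coeff, coeff_C_mul]
    rcases Nat.eq_zero_or_pos n with rfl | hpos
    · simp [hA0]
    · rw [if_neg (by omega), zero_add, Finset.sum_eq_single_of_mem (d - n)
        (Finset.mem_range.mpr (by omega))]
      · rw [Nat.sub_sub_self hn]
        simp
      · intro b _ hb
        simp [hb.symm]
  have hsplit : R.Splits := IsAlgClosed.splits R
  have hcard : R.roots.card = d := by rw [← hsplit.natDegree_eq_card_roots, hdeg]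
  obtain ⟨z, hz⟩ : ∃ z : Fin d → ℂ, (Finset.univ : Finset (Fin d)).val.map z = R.roots := by
    generalize R.roots = s at hcard
    induction s using Quotient.inductionOn with
    | h l =>
      simp only [Multiset.quot_mk_to_coe, Multiset.coe_card] at hcard ⊢
      subst hcard
      exact ⟨l.get, by rw [Fin.univ_val_map, List.ofFn_get]⟩
  have hAz : ∀ n : ℕ, A n = (-1) ^ n * MvPolynomial.aeval z (MvPolynomial.esymm (Fin d) ℂ n) := by
    intro n
    rw [MvPolynomial.aeval_esymm_eq_multiset_esymm, hz]
    rcases le_or_gt n d with hn | hn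
    · rw [← hcoeff n hn]
      have h1 : R = (R.roots.map fun t => X - C t).prod := by
        simpa [hmon.leadingCoeff] using hsplit.eq_prod_roots
      conv_lhs => rw [h1]
      rw [Multiset.prod_X_sub_C_coeff _ (by rw [hcard]; omega), hcard, Nat.sub_sub_self hn]
    · rw [hA n hn, Multiset.esymm, Multiset.powersetCard_eq_empty _ (by rwa [hcard])]
      simp
  refine ⟨z, fun n => ?_⟩
  induction n using Nat.strong_induction_on with
  | _ n ih =>
    intro hn
    have h1 := congrArg (MvPolynomial.aeval z) (MvPolynomial.mul_esymm_eq_sum (Fin d) ℂ n)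
    simp only [map_mul, map_natCast, map_pow, map_neg, map_one, map_sum] at h1
    have h2 : (n : ℂ) * A n = -∑ k ∈ Finset.Icc 1 n, (∑ i, z i ^ k) * A (n - k) := by
      rw [hAz n, ← mul_assoc, mul_comm (n : ℂ), mul_assoc, h1, ← mul_assoc, ← pow_add,
        show n + (n + 1) = 2 * n + 1 by ring, pow_succ, pow_mul, neg_one_sq, one_pow, one_mul,
        neg_one_mul]
      congr 1
      refine Finset.sum_nbij' (fun a => a.2) (fun k => (n - k, k)) ?_ ?_ ?_ ?_ ?_
      · intro a ha
        simp only [Finset.mem_filter, Finset.HasAntidiagonal.mem_antidiagonal, Finset.mem_Icc] at ha ⊢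
        omega
      · intro k hk
        simp only [Finset.mem_filter, Finset.HasAntidiagonal.mem_antidiagonal, Finset.mem_Icc] at hk ⊢
        omega
      · rintro ⟨a, b⟩ ha
        simp only [Finset.mem_filter, Finset.HasAntidiagonal.mem_antidiagonal] at ha
        simp only [Prod.mk.injEq, and_true]
        omega
      · intro k _
        rfl
      · rintro ⟨a, b⟩ ha
        simp only [Finset.mem_filter, Finset.HasAntidiagonal.mem_antidiagonal] at ha
        rw [hAz]
        simp only [MvPolynomial.psum, map_sum, map_pow, MvPolynomial.aeval_X]
        rw [show n - b = a by omega]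
        ring
    obtain ⟨m, rfl⟩ : ∃ m, n = m + 1 := ⟨n - 1, by omega⟩
    rw [hS, Finset.sum_Icc_succ_top (by omega), Finset.sum_Icc_succ_top (by omega), Nat.sub_self,
      hA0, neg_add, ← Finset.sum_neg_distrib, Finset.sum_congr rfl (g := fun k =>
        -((∑ i, z i ^ k) * A (m + 1 - k)))] at h2
    · simpa using h2
    · intro k hk
      rw [Finset.mem_Icc] at hk
      rw [ih k (by omega) hk.1, neg_mul]

lemma norm_le_of_norm_sum_pow_le {d : ℕ} (w : Fin d → ℂ) {ρ B : ℝ} (hρ : 0 < ρ) {m₀ : ℕ}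
    (h : ∀ m ≥ m₀, ‖∑ i, w i ^ m‖ ≤ B * ρ ^ m) (i₀ : Fin d) : ‖w i₀‖ ≤ ρ := by
  classical
  set β := w i₀ with hβ
  set q : ℂ[X] := ∏ b ∈ (Finset.univ.image w).erase β, (X - C b) with hq
  have hqβ : q.eval β ≠ 0 := by
    rw [hq, eval_prod]
    refine Finset.prod_ne_zero_iff.mpr fun b hb => ?_
    have := (Finset.ne_of_mem_erase hb).symm
    simpa [sub_eq_zero] using this
  have hqo : ∀ i, w i ≠ β → q.eval (w i) = 0 := by
    intro i hi
    rw [hq, eval_prod]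
    exact Finset.prod_eq_zero (Finset.mem_erase.mpr ⟨hi, Finset.mem_image_of_mem w
      (Finset.mem_univ i)⟩) (by simp)
  set n : ℕ := (Finset.univ.filter fun i => w i = β).card with hn
  have hn0 : 0 < n := Finset.card_pos.mpr ⟨i₀, by simp [hβ]⟩
  have h1 : ∀ m, ∑ i, w i ^ m * q.eval (w i) = n * (β ^ m * q.eval β) := by
    intro m
    rw [← Finset.sum_filter_add_sum_filter_not Finset.univ (fun i => w i = β),
      Finset.sum_eq_zero (s := Finset.univ.filter fun i => ¬ w i = β), add_zero, hn,
      ← nsmul_eq_mul, ← Finset.sum_const]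
    · exact Finset.sum_congr rfl fun i hi => by rw [(Finset.mem_filter.mp hi).2]
    · intro i hi
      rw [hqo i (Finset.mem_filter.mp hi).2, mul_zero]
  have h2 : ∀ m, ∑ i, w i ^ m * q.eval (w i)
      = ∑ k ∈ Finset.range (q.natDegree + 1), q.coeff k * ∑ i, w i ^ (m + k) := by
    intro m
    simp_rw [eval_eq_sum_range, Finset.mul_sum]
    rw [Finset.sum_comm]
    exact Finset.sum_congr rfl fun k _ => Finset.sum_congr rfl fun i _ => by ring
  set B' : ℝ := ∑ k ∈ Finset.range (q.natDegree + 1), ‖q.coeff k‖ * (B * ρ ^ k) with hB'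
  have h3 : ∀ m ≥ m₀, n * (‖β‖ ^ m * ‖q.eval β‖) ≤ B' * ρ ^ m := by
    intro m hm
    have h4 : ‖(n : ℂ) * (β ^ m * q.eval β)‖ = n * (‖β‖ ^ m * ‖q.eval β‖) := by simp
    rw [← h4, ← h1, h2, hB', Finset.sum_mul]
    refine (norm_sum_le _ _).trans (Finset.sum_le_sum fun k _ => ?_)
    rw [norm_mul, mul_assoc]
    refine mul_le_mul_of_nonneg_left ((h (m + k) (by omega)).trans_eq ?_) (norm_nonneg _)
    ring
  by_contra hlt
  push Not at hlt
  have hqpos : 0 < ‖q.eval β‖ := norm_pos_iff.mpr hqβ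
  have htend := tendsto_pow_atTop_atTop_of_one_lt ((one_lt_div hρ).mpr hlt)
  obtain ⟨m, hm1, hm2⟩ := ((htend.eventually_gt_atTop (B' / ‖q.eval β‖)).and
    (Filter.eventually_ge_atTop m₀)).exists
  have h5 := h3 m hm2
  rw [div_pow, div_lt_div_iff₀ hqpos (pow_pos hρ m)] at hm1
  have h6 : (1 : ℝ) ≤ n := by exact_mod_cast hn0
  have h7 : 0 ≤ ‖β‖ ^ m * ‖q.eval β‖ := by positivity
  nlinarith

section
variable {p : ℕ} [Fact p.Prime] {T : Finset (ZMod p)} {c : ZMod p → ZMod p}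

lemma norm_primePowerSum_le {t₀ : ZMod p} (ht₀ : t₀ ∈ T) (hc : c t₀ ≠ 0) {k : ℕ}
    (hk : T.card + 1 ≤ p ^ k) :
    ‖primePowerSum T c (2 * (k + 1))‖ ≤ (p * (3 * T.card + 1) : ℕ) * (p : ℝ) ^ (k + 1) := by
  classical
  have hp := (Fact.out : p.Prime)
  let K := GaloisField p (2 * (k + 1))
  have : Fintype K := Fintype.ofFinite K
  have hK : Module.finrank (ZMod p) K = 2 * (k + 1) := GaloisField.finrank p (by omega)
  rw [← hK, primePowerSum_eq_sum T c K]
  let Z : ZMod p → Finset K := fun v => Finset.univ.filter fun u : K =>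
    (∀ t ∈ T, u ≠ algebraMap (ZMod p) K t) ∧ Algebra.trace (ZMod p) K
      (∑ t ∈ T, algebraMap (ZMod p) K (c t) * (u - algebraMap (ZMod p) K t)⁻¹) = v
  set M : ℕ := p ^ (2 * k + 1) + (2 * T.card + 1) * p ^ (k + 1) with hM
  have hZ : ∀ v, (Z v).card ≤ M := fun v => card_trace_eq_le ht₀ hc hk hK v
  let good : Finset K := Finset.univ.filter fun u : K => ∀ t ∈ T, u ≠ algebraMap (ZMod p) K t
  have htr : ∀ u : K, Algebra.trace (ZMod p) K
      (∑ t ∈ T, algebraMap (ZMod p) K (c t) * (u - algebraMap (ZMod p) K t)⁻¹) =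
      ∑ t ∈ T, c t * Algebra.trace (ZMod p) K ((u - algebraMap (ZMod p) K t)⁻¹) := by
    intro u
    rw [map_sum]
    refine Finset.sum_congr rfl fun t _ => ?_
    rw [← Algebra.smul_def, map_smul, smul_eq_mul]
  have hfib : ∀ v, (good.filter fun u => Algebra.trace (ZMod p) K
      (∑ t ∈ T, algebraMap (ZMod p) K (c t) * (u - algebraMap (ZMod p) K t)⁻¹) = v) = Z v := by
    intro v
    simp only [good, Z, Finset.filter_filter]
  have hgood : p ^ (2 * (k + 1)) ≤ good.card + T.card := by
    have h1 : Fintype.card K = p ^ (2 * (k + 1)) := by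
      rw [Module.card_eq_pow_finrank (K := ZMod p), hK, ZMod.card]
    have h2 : (Finset.univ : Finset K) ⊆ good ∪ T.image (algebraMap (ZMod p) K) := by
      intro u _
      by_cases h : ∀ t ∈ T, u ≠ algebraMap (ZMod p) K t
      · exact Finset.mem_union_left _ (Finset.mem_filter.mpr ⟨Finset.mem_univ _, h⟩)
      · push Not at h
        obtain ⟨t, ht, rfl⟩ := h
        exact Finset.mem_union_right _ (Finset.mem_image_of_mem _ ht)
    rw [← h1, ← Finset.card_univ]
    exact (Finset.card_le_card h2).trans ((Finset.card_union_le _ _).trans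
      (Nat.add_le_add_left Finset.card_image_le _))
  have hsum : ∑ v, (Z v).card = good.card := by
    rw [Finset.card_eq_sum_card_fiberwise (t := Finset.univ) (f := fun u : K =>
      Algebra.trace (ZMod p) K (∑ t ∈ T, algebraMap (ZMod p) K (c t) *
        (u - algebraMap (ZMod p) K t)⁻¹)) (fun u _ => Finset.mem_univ _)]
    exact Finset.sum_congr rfl fun v _ => by rw [hfib]
  have h1 : (∑ u : K, if ∃ t ∈ T, u = algebraMap (ZMod p) K t then 0 else
        ZMod.stdAddChar (∑ t ∈ T, c t *
          Algebra.trace (ZMod p) K ((u - algebraMap (ZMod p) K t)⁻¹)))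
      = ∑ v : ZMod p, ((Z v).card : ℂ) * ZMod.stdAddChar v := by
    simp_rw [← htr]
    rw [Finset.sum_congr rfl (g := fun u => if ∀ t ∈ T, u ≠ algebraMap (ZMod p) K t then
      ZMod.stdAddChar (Algebra.trace (ZMod p) K (∑ t ∈ T, algebraMap (ZMod p) K (c t) *
        (u - algebraMap (ZMod p) K t)⁻¹)) else 0)]
    · rw [← Finset.sum_filter, ← Finset.sum_fiberwise _ (fun u : K => Algebra.trace (ZMod p) K
        (∑ t ∈ T, algebraMap (ZMod p) K (c t) * (u - algebraMap (ZMod p) K t)⁻¹))]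
      refine Finset.sum_congr rfl fun v _ => ?_
      rw [← nsmul_eq_mul, ← Finset.sum_const]
      change ∑ u ∈ good.filter _, _ = _
      rw [hfib]
      exact Finset.sum_congr rfl fun u hu => by rw [(Finset.mem_filter.mp hu).2.2]
    · intro u _
      by_cases h : ∃ t ∈ T, u = algebraMap (ZMod p) K t
      · rw [if_pos h, if_neg]
        push Not
        exact h
      · rw [if_neg h, if_pos]
        push Not at h
        exact h
  have h0 : ∑ v : ZMod p, (ZMod.stdAddChar v : ℂ) = 0 := by
    have hne : (ZMod.stdAddChar : AddChar (ZMod p) ℂ) ≠ 1 := by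
      have := ZMod.isPrimitive_stdAddChar p (one_ne_zero : (1 : ZMod p) ≠ 0)
      simpa using this
    exact AddChar.sum_eq_zero_of_ne_one hne
  have h2 : ∑ v : ZMod p, ((Z v).card : ℂ) * ZMod.stdAddChar v
      = ∑ v : ZMod p, (-((M - (Z v).card : ℕ) : ℂ)) * ZMod.stdAddChar v := by
    have h3 : ∑ v : ZMod p, (M : ℂ) * ZMod.stdAddChar v = 0 := by rw [← Finset.mul_sum, h0, mul_zero]
    rw [← sub_zero (∑ v : ZMod p, ((Z v).card : ℂ) * ZMod.stdAddChar v), ← h3,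
      ← Finset.sum_sub_distrib]
    refine Finset.sum_congr rfl fun v _ => ?_
    rw [Nat.cast_sub (hZ v)]
    ring
  rw [h1, h2]
  refine (norm_sum_le _ _).trans ?_
  have h4 : ∀ v : ZMod p, ‖(-((M - (Z v).card : ℕ) : ℂ)) * ZMod.stdAddChar v‖
      = ((M - (Z v).card : ℕ) : ℝ) := by
    intro v
    rw [norm_mul, AddChar.norm_apply, mul_one, norm_neg, Complex.norm_natCast]
  simp_rw [h4]
  rw [← Nat.cast_sum]
  have h5 : ∑ v, (M - (Z v).card) + good.card = p * M := by
    rw [← hsum, ← Finset.sum_add_distrib, Finset.sum_congr rfl fun v _ => Nat.sub_add_cancel (hZ v)]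
    simp [ZMod.card]
  have h6 : p * M = p ^ (2 * (k + 1)) + p * (2 * T.card + 1) * p ^ (k + 1) := by
    rw [hM]
    ring
  have h7 : T.card ≤ p * T.card * p ^ (k + 1) := by
    calc T.card = 1 * T.card * 1 := by ring
      _ ≤ _ := by
        gcongr
        · exact hp.one_le
        · exact Nat.one_le_pow _ _ hp.pos
  have h8 : ∑ v, (M - (Z v).card) ≤ p * (3 * T.card + 1) * p ^ (k + 1) := by
    have : p * (3 * T.card + 1) * p ^ (k + 1)
      = p * (2 * T.card + 1) * p ^ (k + 1) + p * T.card * p ^ (k + 1) := by ring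
    omega
  exact_mod_cast h8

open Classical in
/-- Weil's bound for a rational function over `ZMod p` with simple poles. -/
theorem norm_sum_stdAddChar_le {t₀ : ZMod p} (ht₀ : t₀ ∈ T) (hc : c t₀ ≠ 0) :
    ‖∑ u : ZMod p, if u ∈ T then 0 else ZMod.stdAddChar (∑ t ∈ T, c t * (u - t)⁻¹)‖
      ≤ 2 * T.card * √p := by
  have hp := (Fact.out : p.Prime)
  have hp0 : (0 : ℝ) < p := by exact_mod_cast hp.pos
  obtain ⟨z, hz⟩ := exists_eq_neg_sum_pow (d := 2 * T.card) (A := lCoeff T c)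
    (S := primePowerSum T c) lCoeff_zero (fun n hn => lCoeff_eq_zero ht₀ hc hn.le)
    (fun n => mul_lCoeff_eq_sum n)
  obtain ⟨k₀, hk₀⟩ : ∃ k₀, ∀ k ≥ k₀, T.card + 1 ≤ p ^ k :=
    ⟨T.card + 1, fun k hk => hk.le.trans (Nat.lt_pow_self hp.one_lt).le⟩
  have hz2 : ∀ i, ‖z i‖ ^ 2 ≤ p := by
    intro i
    rw [← norm_pow]
    refine norm_le_of_norm_sum_pow_le (fun i => z i ^ 2) (B := (p * (3 * T.card + 1) : ℕ)) hp0
      (m₀ := k₀ + 1) (fun m hm => ?_) i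
    obtain ⟨k, rfl⟩ : ∃ k, m = k + 1 := ⟨m - 1, by omega⟩
    have h1 := norm_primePowerSum_le ht₀ hc (hk₀ k (by omega))
    rw [hz _ (by omega), norm_neg] at h1
    simpa only [← pow_mul] using h1
  have h1 := primePowerSum_eq_sum T c (ZMod p)
  rw [Module.finrank_self, hz 1 le_rfl] at h1
  have h2 : (∑ u : ZMod p, if u ∈ T then 0 else ZMod.stdAddChar (∑ t ∈ T, c t * (u - t)⁻¹))
      = -∑ i, z i ^ 1 := by
    rw [h1]
    refine Finset.sum_congr rfl fun u _ => ?_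
    simp
  rw [h2, norm_neg]
  refine (norm_sum_le _ _).trans ((Finset.sum_le_card_nsmul _ _ (√p) fun i _ => ?_).trans_eq ?_)
  · rw [pow_one]
    exact Real.le_sqrt_of_sq_le (hz2 i)
  · simp

end

end

lemma addChar_map_sum {ι A M : Type*} [AddCommMonoid A] [CommMonoid M] (ψ : AddChar A M)
    (s : Finset ι) (g : ι → A) : ψ (∑ i ∈ s, g i) = ∏ i ∈ s, ψ (g i) := by
  classical
  induction s using Finset.induction_on with
  | empty => simp
  | insert a s ha ih => rw [Finset.sum_insert ha, Finset.prod_insert ha, AddChar.map_add_eq_mul, ih]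

section
variable {p : ℕ} [Fact p.Prime]

lemma psi_eq_stdAddChar (x y u : ZMod p) :
    psi p x y u = if u = 0 then 0 else ZMod.stdAddChar (x * u + y * u⁻¹) := by
  unfold psi
  split_ifs with h
  · rfl
  · conv_rhs => rw [← ZMod.natCast_zmod_val (x * u + y * u⁻¹)]
    have := ZMod.stdAddChar_coe (N := p) ((x * u + y * u⁻¹).val : ℤ)
    push_cast at this
    rw [this]

lemma norm_psi_le_one (x y u : ZMod p) : ‖psi p x y u‖ ≤ 1 := by
  rw [psi_eq_stdAddChar]
  split_ifs
  · simp
  · rw [AddChar.norm_apply]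

open Classical in
lemma norm_sum_prod_psi_le {r : ℕ} (hr : r < p) (x : ZMod p) {y : ZMod p} (hy : y ≠ 0)
    {b b' : Fin r → ZMod p}
    (h : ∃ t, (Finset.univ.filter fun i => b i = t).card
      ≠ (Finset.univ.filter fun i => b' i = t).card) :
    ‖∑ u : ZMod p, (∏ i, psi p x y (u + b i)) * ∏ i, starRingEnd ℂ (psi p x y (u + b' i))‖
      ≤ 4 * r * √p := by
  obtain ⟨t₀, ht₀⟩ := h
  set T : Finset (ZMod p) := Finset.univ.image (fun i => -b i) ∪ Finset.univ.image (fun i => -b' i)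
    with hT
  let N : (Fin r → ZMod p) → ZMod p → ℕ := fun b t => (Finset.univ.filter fun i => b i = t).card
  let c : ZMod p → ZMod p := fun t => y * ((N b (-t) : ZMod p) - N b' (-t))
  have hNr : ∀ b t, N b t ≤ r := fun b t => (Finset.card_filter_le _ _).trans_eq (by simp)
  have hc : c (-t₀) ≠ 0 := by
    refine mul_ne_zero hy (sub_ne_zero.mpr fun h => ht₀ ?_)
    rw [neg_neg, ZMod.natCast_eq_natCast_iff'] at h
    rwa [Nat.mod_eq_of_lt ((hNr _ _).trans_lt hr), Nat.mod_eq_of_lt ((hNr _ _).trans_lt hr)] at h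
  have htT : -t₀ ∈ T := by
    by_contra hn
    rw [hT, Finset.mem_union, Finset.mem_image, Finset.mem_image] at hn
    push Not at hn
    refine ht₀ ?_
    rw [Finset.card_eq_zero.mpr, Finset.card_eq_zero.mpr]
    · rw [Finset.filter_eq_empty_iff]
      exact fun i _ hi => hn.2 i (Finset.mem_univ _) (by rw [hi])
    · rw [Finset.filter_eq_empty_iff]
      exact fun i _ hi => hn.1 i (Finset.mem_univ _) (by rw [hi])
  have hTcard : T.card ≤ 2 * r := by
    refine (Finset.card_union_le _ _).trans ?_
    rw [two_mul]
    exact add_le_add (Finset.card_image_le.trans_eq (by simp))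
      (Finset.card_image_le.trans_eq (by simp))
  have hsum : ∀ (b : Fin r → ZMod p), (∀ i, -b i ∈ T) → ∀ g : ZMod p → ZMod p,
      ∑ i, g (-b i) = ∑ t ∈ T, (N b (-t) : ZMod p) * g t := by
    intro b hb g
    rw [← Finset.sum_fiberwise_of_maps_to (t := T) (g := fun i => -b i) (fun i _ => hb i)]
    refine Finset.sum_congr rfl fun t _ => ?_
    rw [Finset.sum_congr rfl (g := fun _ => g t), Finset.sum_const, nsmul_eq_mul]
    · simp only [N, neg_eq_iff_eq_neg]
    · exact fun i hi => by rw [(Finset.mem_filter.mp hi).2]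
  have hprod : ∀ u : ZMod p,
      (∏ i, psi p x y (u + b i)) * ∏ i, starRingEnd ℂ (psi p x y (u + b' i))
      = ZMod.stdAddChar (x * (∑ i, b i - ∑ i, b' i)) *
        if u ∈ T then 0 else ZMod.stdAddChar (∑ t ∈ T, c t * (u - t)⁻¹) := by
    intro u
    split_ifs with hu
    · rw [mul_zero]
      rw [hT, Finset.mem_union, Finset.mem_image, Finset.mem_image] at hu
      rcases hu with ⟨i, _, rfl⟩ | ⟨i, _, rfl⟩
      · rw [Finset.prod_eq_zero (Finset.mem_univ i) (by simp [psi]), zero_mul]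
      · rw [Finset.prod_eq_zero (i := i) (s := Finset.univ)
          (f := fun j => starRingEnd ℂ (psi p x y (-b' i + b' j))) (Finset.mem_univ i)
          (by simp [psi]), mul_zero]
    · have h1 : ∀ i, u + b i ≠ 0 := fun i h => hu (by
        rw [eq_neg_of_add_eq_zero_left h]
        exact Finset.mem_union_left _ (Finset.mem_image_of_mem (fun i => -b i) (Finset.mem_univ i)))
      have h2 : ∀ i, u + b' i ≠ 0 := fun i h => hu (by
        rw [eq_neg_of_add_eq_zero_left h]
        exact Finset.mem_union_right _
          (Finset.mem_image_of_mem (fun i => -b' i) (Finset.mem_univ i)))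
      simp_rw [psi_eq_stdAddChar, if_neg (h1 _), if_neg (h2 _), ← AddChar.map_neg_eq_conj]
      rw [← addChar_map_sum, ← addChar_map_sum, ← AddChar.map_add_eq_mul,
        ← AddChar.map_add_eq_mul]
      congr 1
      have h3 := hsum b (fun i => Finset.mem_union_left _
        (Finset.mem_image_of_mem (fun i => -b i) (Finset.mem_univ i))) (fun s => (u - s)⁻¹)
      have h4 := hsum b' (fun i => Finset.mem_union_right _
        (Finset.mem_image_of_mem (fun i => -b' i) (Finset.mem_univ i))) (fun s => (u - s)⁻¹)
      simp only [sub_neg_eq_add] at h3 h4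
      simp only [c, mul_assoc, sub_mul, mul_add, neg_add, Finset.sum_add_distrib,
        Finset.sum_neg_distrib, ← Finset.mul_sum, Finset.sum_sub_distrib, ← h3, ← h4]
      simp only [Finset.sum_const]
      ring
  simp_rw [hprod]
  rw [← Finset.mul_sum, norm_mul, AddChar.norm_apply, one_mul]
  refine (norm_sum_stdAddChar_le htT hc).trans ?_
  have : (T.card : ℝ) ≤ 2 * r := by exact_mod_cast hTcard
  nlinarith [Real.sqrt_nonneg p]

open Classical in
lemma card_filter_card_eq_le {α : Type*} (B : Finset α) (r : ℕ) :
    ((Fintype.piFinset (fun _ : Fin r => B) ×ˢ Fintype.piFinset (fun _ : Fin r => B)).filter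
      fun q => ∀ t, (Finset.univ.filter fun i => q.1 i = t).card
        = (Finset.univ.filter fun i => q.2 i = t).card).card ≤ r ^ r * B.card ^ r := by
  have h : ((Fintype.piFinset (fun _ : Fin r => B) ×ˢ Fintype.piFinset (fun _ : Fin r => B)).filter
      fun q => ∀ t, (Finset.univ.filter fun i => q.1 i = t).card
        = (Finset.univ.filter fun i => q.2 i = t).card) ⊆
      ((Finset.univ : Finset (Fin r → Fin r)) ×ˢ Fintype.piFinset (fun _ : Fin r => B)).image
        fun q => (q.2, q.2 ∘ q.1) := by
    rintro ⟨b, b'⟩ hq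
    rw [Finset.mem_filter, Finset.mem_product] at hq
    obtain ⟨⟨hb, _⟩, hq⟩ := hq
    have h1 : ∀ j, ∃ i, b i = b' j := by
      intro j
      have h2 : 0 < (Finset.univ.filter fun i => b i = b' j).card := by
        have := hq (b' j)
        simp only at this
        rw [this]
        exact Finset.card_pos.mpr ⟨j, by simp⟩
      obtain ⟨i, hi⟩ := Finset.card_pos.mp h2
      exact ⟨i, (Finset.mem_filter.mp hi).2⟩
    choose σ hσ using h1
    refine Finset.mem_image.mpr ⟨(σ, b), Finset.mem_product.mpr ⟨Finset.mem_univ _, hb⟩, ?_⟩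
    simp only [Prod.mk.injEq, true_and]
    exact funext hσ
  refine (Finset.card_le_card h).trans (Finset.card_image_le.trans_eq ?_)
  rw [Finset.card_product, Fintype.card_piFinset]
  simp

/-- Moment bound for the sums of `psi` over the translates of a set. -/
lemma sum_norm_sum_psi_pow_le {r : ℕ} (hr : r < p) (x : ZMod p) {y : ZMod p} (hy : y ≠ 0)
    (B : Finset (ZMod p)) :
    ∑ u : ZMod p, ‖∑ b ∈ B, psi p x y (u + b)‖ ^ (2 * r)
      ≤ B.card ^ (2 * r) * (4 * r * √p) + r ^ r * B.card ^ r * p := by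
  classical
  set A := Fintype.piFinset (fun _ : Fin r => B) with hA
  let G : ((Fin r → ZMod p) × (Fin r → ZMod p)) → ℂ := fun q =>
    ∑ u : ZMod p, (∏ i, psi p x y (u + q.1 i)) * ∏ i, starRingEnd ℂ (psi p x y (u + q.2 i))
  have h1 : ∀ u : ZMod p, ((‖∑ b ∈ B, psi p x y (u + b)‖ ^ (2 * r) : ℝ) : ℂ)
      = ∑ q ∈ A ×ˢ A, (∏ i, psi p x y (u + q.1 i)) *
        ∏ i, starRingEnd ℂ (psi p x y (u + q.2 i)) := by
    intro u
    have h2 := Finset.prod_univ_sum (fun _ : Fin r => B) (fun _ b => psi p x y (u + b))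
    have h3 := Finset.prod_univ_sum (fun _ : Fin r => B)
      (fun _ b => starRingEnd ℂ (psi p x y (u + b)))
    rw [Finset.sum_product]
    simp_rw [← Finset.mul_sum, ← Finset.sum_mul]
    rw [← h2, ← h3]
    simp only [Finset.prod_const, Finset.card_univ, Fintype.card_fin]
    rw [← map_sum, ← mul_pow, Complex.mul_conj, Complex.normSq_eq_norm_sq, pow_mul]
    push_cast
    rfl
  have h2 : ((∑ u : ZMod p, ‖∑ b ∈ B, psi p x y (u + b)‖ ^ (2 * r) : ℝ) : ℂ)
      = ∑ q ∈ A ×ˢ A, G q := by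
    rw [Complex.ofReal_sum, Finset.sum_congr rfl fun u _ => h1 u, Finset.sum_comm]
  have h0 : 0 ≤ ∑ u : ZMod p, ‖∑ b ∈ B, psi p x y (u + b)‖ ^ (2 * r) :=
    Finset.sum_nonneg fun u _ => by positivity
  rw [← Complex.norm_of_nonneg h0, h2]
  refine (norm_sum_le _ _).trans ?_
  let deg : ((Fin r → ZMod p) × (Fin r → ZMod p)) → Prop := fun q =>
    ∀ t, (Finset.univ.filter fun i => q.1 i = t).card = (Finset.univ.filter fun i => q.2 i = t).card
  rw [← Finset.sum_filter_add_sum_filter_not _ deg, add_comm]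
  refine add_le_add ?_ ?_
  · refine (Finset.sum_le_card_nsmul _ _ (4 * r * √p) fun q hq => ?_).trans ?_
    · have h3 := (Finset.mem_filter.mp hq).2
      simp only [deg] at h3
      push Not at h3
      exact norm_sum_prod_psi_le hr x hy h3
    · rw [nsmul_eq_mul]
      refine mul_le_mul_of_nonneg_right ?_ (by positivity)
      refine (Nat.cast_le.mpr (Finset.card_filter_le _ _)).trans_eq ?_
      rw [Finset.card_product, hA, Fintype.card_piFinset]
      simp only [Finset.prod_const, Finset.card_univ, Fintype.card_fin]
      push_cast
      ring
  · refine (Finset.sum_le_card_nsmul _ _ (p : ℝ) fun q _ => ?_).trans ?_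
    · refine (norm_sum_le _ _).trans ((Finset.sum_le_card_nsmul _ _ 1 fun u _ => ?_).trans_eq ?_)
      · rw [norm_mul, norm_prod, norm_prod]
        refine mul_le_one₀ (Finset.prod_le_one (fun _ _ => norm_nonneg _)
          fun i _ => norm_psi_le_one _ _ _) (Finset.prod_nonneg fun _ _ => norm_nonneg _)
          (Finset.prod_le_one (fun _ _ => norm_nonneg _) fun i _ => ?_)
        rw [RCLike.norm_conj]
        exact norm_psi_le_one _ _ _
      · simp [ZMod.card]
    · rw [nsmul_eq_mul]
      refine mul_le_mul_of_nonneg_right ?_ (by positivity)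
      have h3 : ((A ×ˢ A).filter deg).card ≤ r ^ r * B.card ^ r := by
        convert card_filter_card_eq_le B r
      exact_mod_cast h3

/-- Hölder's inequality combined with the moment bound. -/
lemma pow_sum_norm_sum_psi_le {ι : Type*} {r : ℕ} (hr0 : 0 < r) (hr : r < p) (x : ZMod p)
    {y : ZMod p} (hy : y ≠ 0) (B : Finset (ZMod p)) (J : Finset ι) {g : ι → ZMod p}
    (hg : Set.InjOn g J) :
    (∑ n ∈ J, ‖∑ b ∈ B, psi p x y (g n + b)‖) ^ (2 * r)
      ≤ J.card ^ (2 * r - 1) *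
        (B.card ^ (2 * r) * (4 * r * √p) + r ^ r * B.card ^ r * p) := by
  classical
  obtain ⟨k, hk⟩ : ∃ k, 2 * r = k + 1 := ⟨2 * r - 1, by omega⟩
  have h2 : ∑ n ∈ J, ‖∑ b ∈ B, psi p x y (g n + b)‖ ^ (2 * r)
      ≤ ∑ u : ZMod p, ‖∑ b ∈ B, psi p x y (u + b)‖ ^ (2 * r) := by
    rw [← Finset.sum_image (f := fun u => ‖∑ b ∈ B, psi p x y (u + b)‖ ^ (2 * r)) hg]
    exact Finset.sum_le_sum_of_subset_of_nonneg (Finset.subset_univ _) fun _ _ _ => by positivity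
  refine le_trans ?_ (mul_le_mul_of_nonneg_left (h2.trans (sum_norm_sum_psi_pow_le hr x hy B))
    (by positivity))
  rcases J.eq_empty_or_nonempty with rfl | hJ
  · simp [hk]
  have h3 := pow_sum_div_card_le_sum_pow (s := J)
    (f := fun n => ‖∑ b ∈ B, psi p x y (g n + b)‖) (fun _ _ => norm_nonneg _) k
  have h4 : (0 : ℝ) < J.card ^ k := pow_pos (by exact_mod_cast hJ.card_pos) k
  rw [div_le_iff₀ h4, mul_comm] at h3
  simpa [hk] using h3

end

/-- `z` is within `Δ` of an integer. -/
def NearInt (Δ z : ℝ) : Prop := Int.fract z < Δ ∨ 1 - Δ ≤ Int.fract z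

lemma floor_eq_add_of_not_nearInt {Δ z w : ℝ} (hz : ¬ NearInt Δ z) {k : ℤ}
    (h : |w - z - k| ≤ Δ) : ⌊w⌋ = ⌊z⌋ + k := by
  simp only [NearInt, not_or, not_lt, not_le] at hz
  have h1 := Int.floor_add_fract z
  rw [abs_le] at h
  rw [Int.floor_eq_iff]
  push_cast
  constructor <;> linarith

lemma norm_sum_sub_sum_shift_le {F : ℕ → ℂ} (hF : ∀ n, ‖F n‖ ≤ 1) (m L s : ℕ) :
    ‖∑ i ∈ Finset.range L, F (m + i) - ∑ i ∈ Finset.range L, F (m + i + s)‖ ≤ 2 * s := by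
  induction s with
  | zero => simp
  | succ s ih =>
    have h1 : ∑ i ∈ Finset.range L, F (m + i + s) - ∑ i ∈ Finset.range L, F (m + i + (s + 1))
        = F (m + s) - F (m + L + s) := by
      rw [← Finset.sum_sub_distrib]
      refine Eq.trans ?_ (Finset.sum_range_sub' (fun i => F (m + i + s)) L)
      refine Finset.sum_congr rfl fun i _ => ?_
      rw [show m + i + (s + 1) = m + (i + 1) + s by ring]
    have h2 : ‖F (m + s) - F (m + L + s)‖ ≤ 2 :=
      (norm_sub_le _ _).trans (by linarith [hF (m + s), hF (m + L + s)])
    rw [← h1] at h2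
    have h3 := norm_sub_le_norm_sub_add_norm_sub (∑ i ∈ Finset.range L, F (m + i))
      (∑ i ∈ Finset.range L, F (m + i + s)) (∑ i ∈ Finset.range L, F (m + i + (s + 1)))
    push_cast
    linarith

section
variable {p : ℕ} [Fact p.Prime]

/-- Hölder's inequality, in a form where the saving `θ` is a parameter. -/
lemma sum_norm_sum_psi_le {ι : Type*} {r : ℕ} (hr0 : 0 < r) (hr : r < p) (x : ZMod p)
    {y : ZMod p} (hy : y ≠ 0) (B : Finset (ZMod p)) (J : Finset ι) {g : ι → ZMod p}
    (hg : Set.InjOn g J) (hB : √p ≤ (B.card : ℝ) ^ r) {θ : ℝ} (hθ : 0 ≤ θ)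
    (hJ : (4 * r + r ^ r) * √p ≤ θ ^ (2 * r) * J.card) :
    ∑ n ∈ J, ‖∑ b ∈ B, psi p x y (g n + b)‖ ≤ B.card * J.card * θ := by
  refine le_of_pow_le_pow_left₀ (n := 2 * r) (by omega) (by positivity) ?_
  refine (pow_sum_norm_sum_psi_le hr0 hr x hy B J hg).trans ?_
  have h1 : (p : ℝ) ≤ √p * (B.card : ℝ) ^ r := by
    calc (p : ℝ) = √p * √p := (Real.mul_self_sqrt (Nat.cast_nonneg p)).symm
      _ ≤ _ := by gcongr
  have h2 : (r : ℝ) ^ r * B.card ^ r * p ≤ r ^ r * √p * (B.card : ℝ) ^ (2 * r) := by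
    calc (r : ℝ) ^ r * B.card ^ r * p ≤ r ^ r * B.card ^ r * (√p * (B.card : ℝ) ^ r) := by gcongr
      _ = _ := by rw [two_mul, pow_add]; ring
  calc (J.card : ℝ) ^ (2 * r - 1) *
        (B.card ^ (2 * r) * (4 * r * √p) + r ^ r * B.card ^ r * p)
      ≤ J.card ^ (2 * r - 1) *
        (B.card ^ (2 * r) * (4 * r * √p) + r ^ r * √p * (B.card : ℝ) ^ (2 * r)) := by gcongr
    _ = J.card ^ (2 * r - 1) * B.card ^ (2 * r) * ((4 * r + r ^ r) * √p) := by ring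
    _ ≤ J.card ^ (2 * r - 1) * B.card ^ (2 * r) * (θ ^ (2 * r) * J.card) := by gcongr
    _ = (J.card ^ (2 * r - 1) * J.card) * B.card ^ (2 * r) * θ ^ (2 * r) := by ring
    _ = (B.card * J.card * θ) ^ (2 * r) := by
      rw [← pow_succ, Nat.sub_add_cancel (by omega)]
      ring

open Classical in
/-- Bound for the sum over a window on which `deriv f` is almost constant. -/
lemma norm_sum_window_le {f : ℝ → ℝ} (hf : Differentiable ℝ f) {m L K Q r : ℕ} (hK : 0 < K)
    (hKp : K ≤ p) (hQ : 0 < Q) (hQK : Q * K ≤ L) (hr0 : 0 < r) (hr : r < p) (x : ZMod p)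
    {y : ZMod p} (hy : y ≠ 0) (hKr : √p ≤ (K : ℝ) ^ r) {θ : ℝ} (hθ : 0 ≤ θ)
    (hθL : (4 * r + r ^ r) * √p ≤ θ ^ (2 * r) * L) {M : ℝ}
    (hf1 : ∀ t ∈ Set.Icc (m : ℝ) (m + 2 * L), 1 ≤ deriv f t ∧ deriv f t ≤ M)
    (hf2 : ∀ t ∈ Set.Icc (m : ℝ) (m + 2 * L), |deriv f t - deriv f m| * (Q : ℝ) ^ 2 ≤ 1)
    (hML : M * L + 1 ≤ p) (hMQ : M * Q + 1 < p) :
    ‖∑ i ∈ Finset.range L, psi p x y ((⌊f (m + i : ℕ)⌋ : ℤ) : ZMod p)‖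
      ≤ L * θ + 2 * ((Finset.range L).filter fun i => NearInt (2 * K / Q) (f (m + i : ℕ))).card
        + 2 * (Q * K) := by
  have hp := (Fact.out : p.Prime)
  have hQ' : (0 : ℝ) < Q := by exact_mod_cast hQ
  have hK' : (0 : ℝ) < K := by exact_mod_cast hK
  have hQKL : (Q : ℝ) * K ≤ L := by exact_mod_cast hQK
  have hmem : (m : ℝ) ∈ Set.Icc (m : ℝ) (m + 2 * L) := ⟨le_rfl, by linarith [mul_pos hQ' hK']⟩
  obtain ⟨a, q, hq0, hqQ, hqa⟩ := Real.exists_int_int_abs_mul_sub_le (deriv f m) hQ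
  obtain ⟨q, rfl⟩ := Int.eq_ofNat_of_zero_le hq0.le
  have hq0' : (1 : ℝ) ≤ q := by exact_mod_cast hq0
  have hqQ' : (q : ℝ) ≤ Q := by exact_mod_cast hqQ
  have hqa' : |deriv f m * q - a| ≤ 1 / Q := by
    refine le_trans (by simpa [mul_comm] using hqa) (one_div_le_one_div_of_le hQ' (by linarith))
  have hqa1 : |deriv f m * q - a| < 1 := by
    refine lt_of_le_of_lt (by simpa [mul_comm] using hqa) ?_
    exact inv_lt_one_of_one_lt₀ (by linarith)
  have hfm := hf1 m hmem
  have ha : (a : ZMod p) ≠ 0 := by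
    rw [abs_lt] at hqa1
    have h1 : (0 : ℝ) < a := by nlinarith
    have h2 : (a : ℝ) < p := by nlinarith
    intro h
    rw [ZMod.intCast_zmod_eq_zero_iff_dvd] at h
    have h3 : (0 : ℤ) < a := by exact_mod_cast h1
    have h4 : a < (p : ℤ) := by exact_mod_cast h2
    exact absurd (Int.le_of_dvd h3 h) (not_le.mpr h4)
  have hderiv : ∀ i < L, ∀ k < K,
      |f (m + i + q * k : ℕ) - f (m + i : ℕ) - ((a * k : ℤ) : ℝ)| ≤ 2 * K / Q := by
    intro i hi k hk
    have hi' : (i : ℝ) + 1 ≤ L := by exact_mod_cast hi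
    have hk' : (k : ℝ) ≤ K := by exact_mod_cast hk.le
    have hqk : (q : ℝ) * k ≤ Q * K := by gcongr
    have h1 : |f (m + i + q * k : ℕ) - f (m + i : ℕ) - deriv f m * (q * k)| ≤ K / Q := by
      rcases Nat.eq_zero_or_pos k with rfl | hk0
      · simp
        positivity
      have hk0' : (0 : ℝ) < k := by exact_mod_cast hk0
      have hlt : ((m + i : ℕ) : ℝ) < ((m + i + q * k : ℕ) : ℝ) := by
        push_cast
        nlinarith
      obtain ⟨ξ, hξ, hξ'⟩ := exists_deriv_eq_slope f hlt hf.continuous.continuousOn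
        hf.differentiableOn
      rw [eq_div_iff (sub_pos.mpr hlt).ne'] at hξ'
      rw [← hξ']
      push_cast at hξ ⊢
      have h2 := hf2 ξ ⟨by linarith [hξ.1, (Nat.cast_nonneg i : (0 : ℝ) ≤ i)], by linarith [hξ.2]⟩
      rw [show deriv f ξ * (m + i + q * k - (m + i)) - deriv f m * (q * k)
        = (deriv f ξ - deriv f m) * (q * k) by ring, abs_mul, abs_of_nonneg (a := (q : ℝ) * k)
        (by positivity), le_div_iff₀ hQ']
      calc |deriv f ξ - deriv f m| * (q * k) * Q ≤ |deriv f ξ - deriv f m| * (Q * K) * Q := by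
            gcongr
        _ = |deriv f ξ - deriv f m| * Q ^ 2 * K := by ring
        _ ≤ 1 * K := by gcongr
        _ = K := one_mul _
    have h2 : |(deriv f m * q - a) * k| ≤ K / Q := by
      rw [abs_mul, Nat.abs_cast]
      calc |deriv f m * q - a| * k ≤ 1 / Q * K := by gcongr
        _ = K / Q := by ring
    push_cast at h1 ⊢
    have h3 := abs_add_le (f (m + i + q * k) - f (m + i) - deriv f m * (q * k))
      ((deriv f m * q - a) * k)
    rw [show f (m + i + q * k) - f (m + i) - deriv f m * (q * k) + (deriv f m * q - a) * k
      = f (m + i + q * k) - f (m + i) - a * k by ring] at h3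
    calc _ ≤ _ := h3
      _ ≤ K / Q + K / Q := add_le_add h1 h2
      _ = _ := by ring
  set F : ℕ → ℂ := fun n => psi p x y ((⌊f n⌋ : ℤ) : ZMod p) with hF
  have hF1 : ∀ n, ‖F n‖ ≤ 1 := fun n => norm_psi_le_one _ _ _
  set bad := (Finset.range L).filter fun i => NearInt (2 * K / Q) (f (m + i : ℕ)) with hbad
  let g : ℕ → ZMod p := fun i => ((⌊f (m + i : ℕ)⌋ : ℤ) : ZMod p)
  have hgood : ∀ i ∈ Finset.range L, i ∉ bad → ∀ k < K,
      F (m + i + q * k) = psi p x y (g i + a * (k : ZMod p)) := by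
    intro i hi hib k hk
    have h1 : ¬ NearInt (2 * K / Q) (f (m + i : ℕ)) := fun h =>
      hib (Finset.mem_filter.mpr ⟨hi, h⟩)
    simp only [hF, g]
    rw [floor_eq_add_of_not_nearInt h1 (hderiv i (Finset.mem_range.mp hi) k hk)]
    push_cast
    rfl
  have hinj : Set.InjOn (fun k : ℕ => (a : ZMod p) * (k : ZMod p)) (Finset.range K) := by
    intro k hk k' hk' h
    have hk := Finset.mem_range.mp hk
    have hk' := Finset.mem_range.mp hk'
    have h1 := mul_left_cancel₀ ha h
    rw [ZMod.natCast_eq_natCast_iff'] at h1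
    rwa [Nat.mod_eq_of_lt (by omega), Nat.mod_eq_of_lt (by omega)] at h1
  set B := (Finset.range K).image fun k : ℕ => (a : ZMod p) * (k : ZMod p) with hB
  have hBcard : B.card = K := by rw [hB, Finset.card_image_of_injOn hinj, Finset.card_range]
  have hBsum : ∀ i, ∑ k ∈ Finset.range K, psi p x y (g i + a * (k : ZMod p))
      = ∑ b ∈ B, psi p x y (g i + b) := fun i => by
    rw [hB, Finset.sum_image hinj]
  have hmono : ∀ i j, i < j → j < L → f (m + i : ℕ) + 1 ≤ f (m + j : ℕ) ∧
      f (m + j : ℕ) ≤ f (m + i : ℕ) + M * (L - 1) := by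
    intro i j hij hj
    have hij' : (i : ℝ) + 1 ≤ j := by exact_mod_cast hij
    have hj' : (j : ℝ) + 1 ≤ L := by exact_mod_cast hj
    have hi0 : (0 : ℝ) ≤ i := Nat.cast_nonneg i
    have hlt : ((m + i : ℕ) : ℝ) < ((m + j : ℕ) : ℝ) := by exact_mod_cast (by omega)
    obtain ⟨ξ, hξ, hξ'⟩ := exists_deriv_eq_slope f hlt hf.continuous.continuousOn
      hf.differentiableOn
    rw [eq_div_iff (sub_pos.mpr hlt).ne'] at hξ'
    push_cast at hξ hξ' ⊢
    obtain ⟨h1, h2⟩ := hf1 ξ ⟨by linarith [hξ.1], by linarith [hξ.2]⟩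
    constructor <;> nlinarith
  have hginj : Set.InjOn g (Finset.range L) := by
    have key : ∀ i j, i < j → j < L → g i ≠ g j := by
      intro i j hij hj h
      obtain ⟨h1, h2⟩ := hmono i j hij hj
      simp only [g] at h
      rw [ZMod.intCast_eq_intCast_iff_dvd_sub] at h
      have h3 := Int.floor_le (f (m + i : ℕ))
      have h4 := Int.lt_floor_add_one (f (m + i : ℕ))
      have h5 := Int.floor_le (f (m + j : ℕ))
      have h6 := Int.lt_floor_add_one (f (m + j : ℕ))
      have h7 : (0 : ℝ) < ((⌊f (m + j : ℕ)⌋ - ⌊f (m + i : ℕ)⌋ : ℤ) : ℝ) := by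
        push_cast at *
        linarith
      have h8 : ((⌊f (m + j : ℕ)⌋ - ⌊f (m + i : ℕ)⌋ : ℤ) : ℝ) < (p : ℤ) := by
        push_cast at *
        linarith [hfm.1, hfm.2]
      have h7' : 0 < ⌊f (m + j : ℕ)⌋ - ⌊f (m + i : ℕ)⌋ := by exact_mod_cast h7
      have h8' : ⌊f (m + j : ℕ)⌋ - ⌊f (m + i : ℕ)⌋ < (p : ℤ) := by exact_mod_cast h8
      exact absurd (Int.le_of_dvd h7' h) (not_le.mpr h8')
    intro i hi j hj h
    rcases lt_trichotomy i j with hij | hij | hij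
    · exact absurd h (key i j hij (Finset.mem_range.mp hj))
    · exact hij
    · exact absurd h.symm (key j i hij (Finset.mem_range.mp hi))
  have hmain : ∑ i ∈ Finset.range L, ‖∑ b ∈ B, psi p x y (g i + b)‖ ≤ K * L * θ := by
    have := sum_norm_sum_psi_le hr0 hr x hy B (Finset.range L) hginj (by rwa [hBcard]) hθ
      (by rwa [Finset.card_range])
    rwa [hBcard, Finset.card_range] at this
  have hswap : ∑ k ∈ Finset.range K, ∑ i ∈ Finset.range L, F (m + i + q * k)
      = ∑ i ∈ Finset.range L, ∑ k ∈ Finset.range K, F (m + i + q * k) := Finset.sum_comm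
  have h1 : ‖∑ k ∈ Finset.range K, ∑ i ∈ Finset.range L, F (m + i + q * k)‖
      ≤ K * L * θ + 2 * K * bad.card := by
    rw [hswap]
    refine (norm_sum_le _ _).trans ?_
    have h2 : ∀ i ∈ Finset.range L, ‖∑ k ∈ Finset.range K, F (m + i + q * k)‖
        ≤ ‖∑ b ∈ B, psi p x y (g i + b)‖ + if i ∈ bad then (2 * K : ℝ) else 0 := by
      intro i hi
      split_ifs with hib
      · have h3 : ‖∑ k ∈ Finset.range K, F (m + i + q * k)‖ ≤ K := by
          refine (norm_sum_le _ _).trans ((Finset.sum_le_card_nsmul _ _ 1 fun k _ => hF1 _).trans ?_)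
          simp
        linarith [norm_nonneg (∑ b ∈ B, psi p x y (g i + b))]
      · rw [add_zero, ← hBsum, Finset.sum_congr rfl fun k hk => hgood i hi hib k
          (Finset.mem_range.mp hk)]
    refine (Finset.sum_le_sum h2).trans ?_
    rw [Finset.sum_add_distrib]
    refine add_le_add hmain ?_
    rw [Finset.sum_ite_mem, Finset.sum_const, nsmul_eq_mul, mul_comm]
    gcongr
    exact Finset.inter_subset_right
  have h2 : ‖(K : ℂ) * ∑ i ∈ Finset.range L, F (m + i)
      - ∑ k ∈ Finset.range K, ∑ i ∈ Finset.range L, F (m + i + q * k)‖ ≤ K * (2 * (Q * K)) := by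
    have h3 : (K : ℂ) * ∑ i ∈ Finset.range L, F (m + i)
        = ∑ k ∈ Finset.range K, ∑ i ∈ Finset.range L, F (m + i) := by simp
    rw [h3, ← Finset.sum_sub_distrib]
    refine (norm_sum_le _ _).trans ((Finset.sum_le_card_nsmul _ _ (2 * (Q * K) : ℝ)
      fun k hk => (norm_sum_sub_sum_shift_le hF1 m L (q * k)).trans ?_).trans_eq ?_)
    · have hk' : (k : ℝ) ≤ K := by exact_mod_cast (Finset.mem_range.mp hk).le
      push_cast
      gcongr
    · simp
  have h4 := norm_le_norm_add_norm_sub' ((K : ℂ) * ∑ i ∈ Finset.range L, F (m + i))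
    (∑ k ∈ Finset.range K, ∑ i ∈ Finset.range L, F (m + i + q * k))
  rw [norm_mul, Complex.norm_natCast] at h4
  refine le_of_mul_le_mul_left ?_ hK'
  calc _ ≤ _ := h4
    _ ≤ (K * L * θ + 2 * K * bad.card) + K * (2 * (Q * K)) := add_le_add h1 h2
    _ = _ := by ring

open Classical in
/-- Averaging over windows. -/
lemma norm_sum_Ico_le_of_window {F : ℕ → ℂ} (hF : ∀ n, ‖F n‖ ≤ 1) {A B L : ℕ} (hL : 0 < L)
    (hAB : A ≤ B) {bad : ℕ → Prop} {E : ℝ}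
    (h : ∀ m ∈ Finset.Ico A B, ‖∑ i ∈ Finset.range L, F (m + i)‖
      ≤ E + 2 * ((Finset.range L).filter fun i => bad (m + i)).card) :
    ‖∑ n ∈ Finset.Ico A B, F n‖ ≤ 2 * L + (B - A) * (E / L)
      + 2 * ((Finset.Ico A (B + L)).filter bad).card := by
  have hL' : (0 : ℝ) < L := by exact_mod_cast hL
  have h1 : ‖(L : ℂ) * ∑ n ∈ Finset.Ico A B, F n
      - ∑ i ∈ Finset.range L, ∑ n ∈ Finset.Ico A B, F (n + i)‖ ≤ L * (2 * L) := by
    have h3 : (L : ℂ) * ∑ n ∈ Finset.Ico A B, F n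
        = ∑ i ∈ Finset.range L, ∑ n ∈ Finset.Ico A B, F n := by simp
    rw [h3, ← Finset.sum_sub_distrib]
    refine (norm_sum_le _ _).trans ((Finset.sum_le_card_nsmul _ _ (2 * L : ℝ)
      fun i hi => ?_).trans_eq ?_)
    · have hi' : (i : ℝ) ≤ L := by exact_mod_cast (Finset.mem_range.mp hi).le
      rw [Finset.sum_Ico_eq_sum_range, Finset.sum_Ico_eq_sum_range]
      refine (norm_sum_sub_sum_shift_le hF A (B - A) i).trans ?_
      gcongr
    · simp
  have h2 : ‖∑ i ∈ Finset.range L, ∑ n ∈ Finset.Ico A B, F (n + i)‖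
      ≤ (B - A) * E + 2 * (L * ((Finset.Ico A (B + L)).filter bad).card) := by
    rw [Finset.sum_comm]
    refine (norm_sum_le _ _).trans ((Finset.sum_le_sum h).trans ?_)
    rw [Finset.sum_add_distrib, Finset.sum_const, Nat.card_Ico, nsmul_eq_mul, Nat.cast_sub hAB,
      ← Finset.mul_sum]
    gcongr
    set b := (Finset.Ico A (B + L)).filter bad with hb
    simp_rw [Finset.card_filter]
    push_cast
    rw [Finset.sum_comm]
    refine (Finset.sum_le_card_nsmul _ _ (b.card : ℝ)
      fun i hi => ?_).trans_eq ?_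
    · rw [← Finset.sum_filter, Finset.sum_const, nsmul_eq_mul, mul_one, Nat.cast_le]
      refine Finset.card_le_card_of_injOn (fun n => n + i) ?_ (add_left_injective i).injOn
      intro n hn
      simp only [hb, Finset.coe_filter, Finset.mem_Ico, Set.mem_ofPred_eq] at hn ⊢
      have := Finset.mem_range.mp hi
      exact ⟨⟨by omega, by omega⟩, hn.2⟩
    · simp
  have h4 := norm_le_norm_add_norm_sub' ((L : ℂ) * ∑ n ∈ Finset.Ico A B, F n)
    (∑ i ∈ Finset.range L, ∑ n ∈ Finset.Ico A B, F (n + i))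
  rw [norm_mul, Complex.norm_natCast] at h4
  refine le_of_mul_le_mul_left ?_ hL'
  calc _ ≤ _ := h4
    _ ≤ _ := add_le_add h2 h1
    _ = _ := by field_simp; ring

end

lemma card_le_of_spaced {S : Finset ℕ} {φ : ℕ → ℝ} {l a b : ℝ} (hl : 0 < l) (hab : a ≤ b)
    (hφ : ∀ n ∈ S, ∀ n' ∈ S, n < n' → l * (n' - n) ≤ φ n' - φ n)
    (hmem : ∀ n ∈ S, φ n ∈ Set.Icc a b) : (S.card : ℝ) ≤ (b - a) / l + 1 := by
  rcases S.eq_empty_or_nonempty with rfl | hS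
  · simp only [Finset.card_empty, Nat.cast_zero]
    have := div_nonneg (sub_nonneg.mpr hab) hl.le
    linarith
  have hle : S.min' hS ≤ S.max' hS := S.min'_le_max' hS
  have h1 : S ⊆ Finset.Icc (S.min' hS) (S.max' hS) := fun n hn =>
    Finset.mem_Icc.mpr ⟨S.min'_le n hn, S.le_max' n hn⟩
  have h2 : (S.card : ℝ) ≤ S.max' hS - S.min' hS + 1 := by
    have := Finset.card_le_card h1
    rw [Nat.card_Icc] at this
    have h3 : S.card + S.min' hS ≤ S.max' hS + 1 := by omega
    have h4 : (S.card : ℝ) + S.min' hS ≤ S.max' hS + 1 := by exact_mod_cast h3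
    linarith
  have h3 : ((S.max' hS : ℝ) - S.min' hS) ≤ (b - a) / l := by
    rw [le_div_iff₀ hl]
    rcases hle.eq_or_lt with h | h
    · rw [h]
      linarith
    · linarith [hφ _ (S.min'_mem hS) _ (S.max'_mem hS) h, (hmem _ (S.min'_mem hS)).1,
        (hmem _ (S.max'_mem hS)).2]
  linarith

lemma card_le_of_near_round {S : Finset ℕ} {φ : ℕ → ℝ} {l₁ l₂ δ : ℝ} {A B : ℕ} (hAB : A ≤ B)
    (hl : 0 < l₁) (hl₂ : 0 ≤ l₂) (hδ : 0 ≤ δ) (hS : S ⊆ Finset.Ico A B)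
    (hφ : ∀ n ∈ S, ∀ n' ∈ S, n < n' → l₁ * (n' - n) ≤ φ n' - φ n ∧ φ n' - φ n ≤ l₂ * (n' - n))
    (hround : ∀ n ∈ S, |φ n - round (φ n)| ≤ δ) :
    (S.card : ℝ) ≤ (l₂ * (B - A) + 2) * (2 * δ / l₁ + 1) := by
  rcases S.eq_empty_or_nonempty with rfl | hne
  · have h' : (A : ℝ) ≤ B := by exact_mod_cast hAB
    have := mul_nonneg hl₂ (sub_nonneg.mpr h')
    simp only [Finset.card_empty, Nat.cast_zero]
    positivity
  have hlo := S.min'_mem hne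
  have hhi := S.max'_mem hne
  have hmono : ∀ n ∈ S, ∀ n' ∈ S, n ≤ n' → φ n ≤ φ n' := by
    intro n hn n' hn' h
    rcases h.eq_or_lt with rfl | h
    · exact le_rfl
    · have h1 : (n : ℝ) < n' := by exact_mod_cast h
      have := (hφ n hn n' hn' h).1
      nlinarith
  have himg : S.image (fun n => round (φ n)) ⊆
      Finset.Icc (round (φ (S.min' hne))) (round (φ (S.max' hne))) := by
    intro k hk
    obtain ⟨n, hn, rfl⟩ := Finset.mem_image.mp hk
    rw [Finset.mem_Icc]
    simp only [round_eq]
    exact ⟨Int.floor_le_floor (by linarith [hmono _ hlo n hn (S.min'_le n hn)]),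
      Int.floor_le_floor (by linarith [hmono n hn _ hhi (S.le_max' n hn)])⟩
  have hdiff : ((S.max' hne : ℝ) - S.min' hne) ≤ B - A := by
    have h1 : (A : ℝ) ≤ S.min' hne := by exact_mod_cast (Finset.mem_Ico.mp (hS hlo)).1
    have h2 : (S.max' hne : ℝ) ≤ B := by exact_mod_cast (Finset.mem_Ico.mp (hS hhi)).2.le
    linarith
  have hcard : ((S.image fun n => round (φ n)).card : ℝ) ≤ l₂ * (B - A) + 2 := by
    have hle : round (φ (S.min' hne)) ≤ round (φ (S.max' hne)) :=
      (Finset.mem_Icc.mp (himg (Finset.mem_image_of_mem _ hlo))).2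
    have h1 := Finset.card_le_card himg
    rw [Int.card_Icc] at h1
    have h2 : ((S.image fun n => round (φ n)).card : ℤ)
      ≤ round (φ (S.max' hne)) + 1 - round (φ (S.min' hne)) := by omega
    have h3 : ((S.image fun n => round (φ n)).card : ℝ)
      ≤ round (φ (S.max' hne)) + 1 - round (φ (S.min' hne)) := by exact_mod_cast h2
    have h4 := abs_le.mp (abs_sub_round (φ (S.max' hne)))
    have h5 := abs_le.mp (abs_sub_round (φ (S.min' hne)))
    have h6 : φ (S.max' hne) - φ (S.min' hne) ≤ l₂ * (S.max' hne - S.min' hne) := by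
      rcases (S.min'_le_max' hne).eq_or_lt with h | h
      · rw [h]
        simp
      · exact (hφ _ hlo _ hhi h).2
    have h7 := mul_le_mul_of_nonneg_left hdiff hl₂
    linarith [h4.1, h5.2]
  have hfib : ∀ k ∈ S.image (fun n => round (φ n)),
      (S.filter fun n => round (φ n) = k).card ≤ ⌊2 * δ / l₁ + 1⌋₊ := by
    intro k _
    refine Nat.le_floor ?_
    have := card_le_of_spaced (S := S.filter fun n => round (φ n) = k) (φ := φ) (a := k - δ)
      (b := k + δ) hl (by linarith)
      (fun n hn n' hn' h => (hφ n (Finset.mem_filter.mp hn).1 n' (Finset.mem_filter.mp hn').1 h).1)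
      (fun n hn => by
        obtain ⟨h1, rfl⟩ := Finset.mem_filter.mp hn
        have := abs_le.mp (hround n h1)
        constructor <;> linarith [this.1, this.2])
    rwa [show (k : ℝ) + δ - (k - δ) = 2 * δ by ring] at this
  have h1 := Finset.card_le_mul_card_image S _ hfib
  have h2 : (S.card : ℝ) ≤ (⌊2 * δ / l₁ + 1⌋₊ : ℝ) * (S.image fun n => round (φ n)).card := by
    exact_mod_cast h1
  refine h2.trans ?_
  rw [mul_comm]
  exact mul_le_mul hcard (Nat.floor_le (by positivity)) (Nat.cast_nonneg _)
    ((Nat.cast_nonneg _).trans hcard)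

lemma NearInt.abs_sub_round_le {Δ z : ℝ} (h : NearInt Δ z) : |z - round z| ≤ Δ := by
  rw [abs_sub_round_eq_min]
  rcases h with h | h
  · exact (min_le_left _ _).trans h.le
  · exact (min_le_right _ _).trans (by linarith)

lemma NearInt.abs_sub_sub_round_le {Δ z w : ℝ} (hz : NearInt Δ z) (hw : NearInt Δ w) :
    |w - z - round (w - z)| ≤ 2 * Δ := by
  refine (round_le (w - z) (round w - round z)).trans ?_
  have h1 := abs_le.mp hz.abs_sub_round_le
  have h2 := abs_le.mp hw.abs_sub_round_le
  push_cast
  rw [abs_le]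
  constructor <;> linarith [h1.1, h1.2, h2.1, h2.2]

/-- A set of integers in which close pairs with a given difference are rare is small. -/
lemma card_le_of_pairs {S : Finset ℕ} {A B H : ℕ} (hH : 0 < H) (hAB : A ≤ B)
    (hS : S ⊆ Finset.Ico A B) {E : ℝ}
    (hE : ∀ h : ℕ, 0 < h → h < H → ((S.filter fun n => n + h ∈ S).card : ℝ) ≤ E) (hE0 : 0 ≤ E) :
    (S.card : ℝ) ≤ (B - A) / H + 1 + H * E := by
  set P : Finset ℕ := (Finset.Ioo 0 H).biUnion fun h => S.filter fun n => n + h ∈ S with hP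
  have hPS : P ⊆ S := Finset.biUnion_subset.mpr fun h _ => Finset.filter_subset _ _
  have h1 : (P.card : ℝ) ≤ H * E := by
    have h2 : (P.card : ℝ) ≤ ∑ h ∈ Finset.Ioo (0 : ℕ) H, ((S.filter fun n => n + h ∈ S).card : ℝ) := by
      exact_mod_cast Finset.card_biUnion_le
    refine h2.trans ((Finset.sum_le_card_nsmul (Finset.Ioo 0 H) _ E fun h hh => ?_).trans ?_)
    · have hh := Finset.mem_Ioo.mp hh
      exact hE h hh.1 hh.2
    · rw [nsmul_eq_mul, Nat.card_Ioo]
      gcongr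
      omega
  have h2 : (S \ P).card ≤ (B - A) / H + 1 := by
    rw [← Finset.card_range ((B - A) / H + 1)]
    refine Finset.card_le_card_of_injOn (fun n => (n - A) / H) ?_ ?_
    · intro n hn
      have h3 := Finset.mem_Ico.mp (hS (Finset.mem_sdiff.mp hn).1)
      simp only [Finset.coe_range, Set.mem_Iio]
      exact Nat.lt_succ_of_le (Nat.div_le_div_right (by omega))
    · have key : ∀ n ∈ S \ P, ∀ n' ∈ S \ P, n < n' → (n - A) / H ≠ (n' - A) / H := by
        intro n hn n' hn' hlt heq
        rw [Finset.mem_sdiff] at hn hn'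
        have h3 := Finset.mem_Ico.mp (hS hn.1)
        have h4 := Finset.mem_Ico.mp (hS hn'.1)
        have h5 : n' - n < H := by
          have h6 := Nat.div_add_mod (n - A) H
          have h7 := Nat.div_add_mod (n' - A) H
          have h8 := Nat.mod_lt (n' - A) hH
          rw [heq] at h6
          omega
        refine hn.2 (Finset.mem_biUnion.mpr ⟨n' - n, Finset.mem_Ioo.mpr ⟨by omega, h5⟩,
          Finset.mem_filter.mpr ⟨hn.1, ?_⟩⟩)
        rw [show n + (n' - n) = n' by omega]
        exact hn'.1
      intro n hn n' hn' h
      rcases lt_trichotomy n n' with hlt | hlt | hlt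
      · exact absurd h (key n hn n' hn' hlt)
      · exact hlt
      · exact absurd h.symm (key n' hn' n hn hlt)
  have h3 : ((S \ P).card : ℝ) ≤ (B - A) / H + 1 := by
    calc ((S \ P).card : ℝ) ≤ (((B - A) / H : ℕ) : ℝ) + 1 := by exact_mod_cast h2
      _ ≤ ((B - A : ℕ) : ℝ) / H + 1 := by gcongr; exact Nat.cast_div_le
      _ = _ := by rw [Nat.cast_sub hAB]
  have h4 : (S.card : ℝ) = (S \ P).card + P.card := by
    exact_mod_cast (Finset.card_sdiff_add_card_eq_card hPS).symm
  linarith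

open Classical in
/-- Number of `n` for which `f n` is close to an integer, for a convex function `f`. -/
lemma card_filter_nearInt_le {f : ℝ → ℝ} (hf : Differentiable ℝ f)
    (hf' : Differentiable ℝ (deriv f)) {A B H : ℕ} (hAB : A ≤ B) (hH : 0 < H)
    {μ₁ μ₂ Δ : ℝ} (hμ₁ : 0 < μ₁) (hΔ : 0 ≤ Δ)
    (hf2 : ∀ t ∈ Set.Icc (A : ℝ) B, μ₁ ≤ deriv (deriv f) t ∧ deriv (deriv f) t ≤ μ₂) :
    (((Finset.Ico A B).filter fun n : ℕ => NearInt Δ (f n)).card : ℝ) ≤ (B - A) / H + 1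
      + H * (4 * Δ * (μ₂ / μ₁) * (B - A) + H * μ₂ * (B - A) + 8 * Δ / μ₁ + 2) := by
  have hAB' : (A : ℝ) ≤ B := by exact_mod_cast hAB
  have hBA : (0 : ℝ) ≤ B - A := sub_nonneg.mpr hAB'
  have hμ : μ₁ ≤ μ₂ := (hf2 A ⟨le_rfl, hAB'⟩).1.trans (hf2 A ⟨le_rfl, hAB'⟩).2
  have hμ₂ : 0 < μ₂ := hμ₁.trans_le hμ
  refine card_le_of_pairs hH hAB (Finset.filter_subset _ _) (fun h h0 hh => ?_) (by positivity)
  have h0' : (1 : ℝ) ≤ h := by exact_mod_cast h0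
  have hh' : (h : ℝ) ≤ H := by exact_mod_cast hh.le
  set S := (Finset.Ico A B).filter fun n : ℕ => NearInt Δ (f n) with hS
  set T := S.filter fun n => n + h ∈ S with hT
  have hTS : T ⊆ S := Finset.filter_subset _ _
  have key := card_le_of_near_round (S := T) (φ := fun n : ℕ => f (n + h : ℕ) - f n)
    (l₁ := h * μ₁) (l₂ := h * μ₂) (δ := 2 * Δ) hAB (by positivity) (by positivity)
    (by positivity) (hTS.trans (Finset.filter_subset _ _)) ?_ ?_
  · refine key.trans ?_
    rw [show 2 * (2 * Δ) / (h * μ₁) = 4 * Δ / μ₁ / h by field_simp; ring]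
    have h1 : (h * μ₂ * (B - A) + 2) * (4 * Δ / μ₁ / h + 1)
        = 4 * Δ * (μ₂ / μ₁) * (B - A) + h * μ₂ * (B - A) + 8 * Δ / μ₁ / h + 2 := by
      field_simp
      ring
    rw [h1]
    have h2 : 8 * Δ / μ₁ / h ≤ 8 * Δ / μ₁ := div_le_self (by positivity) h0'
    gcongr
  · intro n hn n' hn' hlt
    have hlt' : (n : ℝ) < n' := by exact_mod_cast hlt
    have hn1 := Finset.mem_Ico.mp (Finset.mem_filter.mp (hTS hn)).1
    have hn2 := Finset.mem_Ico.mp (Finset.mem_filter.mp (Finset.mem_filter.mp hn').2).1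
    have hA : (A : ℝ) ≤ n := by exact_mod_cast hn1.1
    have hB : (n' + h : ℝ) ≤ B := by exact_mod_cast hn2.2.le
    have hder : ∀ t, HasDerivAt (fun t : ℝ => f (t + h) - f t) (deriv f (t + h) - deriv f t) t :=
      fun t => ((hf (t + h)).hasDerivAt.comp_add_const t h).sub (hf t).hasDerivAt
    obtain ⟨ξ, hξ, hξ'⟩ := exists_hasDerivAt_eq_slope (fun t : ℝ => f (t + h) - f t)
      (fun t => deriv f (t + h) - deriv f t) hlt'
      (fun t _ => (hder t).continuousAt.continuousWithinAt) (fun t _ => hder t)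
    obtain ⟨η, hη, hη'⟩ := exists_deriv_eq_slope (deriv f) (show ξ < ξ + h by linarith)
      hf'.continuous.continuousOn hf'.differentiableOn
    rw [eq_div_iff (by linarith)] at hξ' hη'
    obtain ⟨h1, h2⟩ := hf2 η ⟨by linarith [hη.1, hξ.1], by linarith [hη.2, hξ.2]⟩
    have h3 : f (n' + h : ℕ) - f n' - (f (n + h : ℕ) - f n)
        = deriv (deriv f) η * h * (n' - n) := by
      push_cast
      rw [← hξ', ← hη']
      ring
    rw [h3]
    have h4 : (0 : ℝ) ≤ n' - n := by linarith
    constructor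
    · rw [mul_comm (h : ℝ) μ₁]
      gcongr
    · rw [mul_comm (h : ℝ) μ₂]
      gcongr
  · intro n hn
    obtain ⟨h1, h2⟩ := Finset.mem_filter.mp hn
    exact (Finset.mem_filter.mp h1).2.abs_sub_sub_round_le (Finset.mem_filter.mp h2).2

section
variable {p : ℕ} [Fact p.Prime]

lemma norm_sum_Icc_psi_le {f : ℝ → ℝ} (hf : Differentiable ℝ f)
    (hf' : Differentiable ℝ (deriv f)) {A N L K Q H r : ℕ} (hA : 1 ≤ A) (hAN : A ≤ N)
    (hLN : 2 * L ≤ N) (hK : 0 < K) (hKp : K ≤ p) (hQ : 0 < Q) (hQK : Q * K ≤ L) (hH : 0 < H)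
    (hr0 : 0 < r) (hr : r < p) (x : ZMod p) {y : ZMod p} (hy : y ≠ 0) (hKr : √p ≤ (K : ℝ) ^ r)
    {θ : ℝ} (hθ : 0 ≤ θ) (hθL : (4 * r + r ^ r) * √p ≤ θ ^ (2 * r) * L) {M μ₁ μ₂ : ℝ}
    (hμ₁ : 0 < μ₁)
    (hf1 : ∀ t ∈ Set.Icc (A : ℝ) (3 * N), 1 ≤ deriv f t ∧ deriv f t ≤ M)
    (hf2 : ∀ t ∈ Set.Icc (A : ℝ) (3 * N), μ₁ ≤ deriv (deriv f) t ∧ deriv (deriv f) t ≤ μ₂)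
    (hμL : 2 * L * μ₂ * (Q : ℝ) ^ 2 ≤ 1) (hML : M * L + 1 ≤ p) (hMQ : M * Q + 1 < p) :
    ‖∑ n ∈ Finset.Icc 1 N, psi p x y ((⌊f n⌋ : ℤ) : ZMod p)‖ ≤ A + 2 * L
      + N * (θ + 2 * (Q * K) / L) + 2 * (3 * N / H + 1 + H * (4 * (2 * K / Q) * (μ₂ / μ₁) * (3 * N)
        + H * μ₂ * (3 * N) + 8 * (2 * K / Q) / μ₁ + 2)) := by
  classical
  set F : ℕ → ℂ := fun n => psi p x y ((⌊f n⌋ : ℤ) : ZMod p) with hF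
  have hF1 : ∀ n, ‖F n‖ ≤ 1 := fun n => norm_psi_le_one _ _ _
  have hL : 0 < L := (Nat.mul_pos hQ hK).trans_le hQK
  have hL' : (0 : ℝ) < L := by exact_mod_cast hL
  have hA' : (1 : ℝ) ≤ A := by exact_mod_cast hA
  have hAN' : (A : ℝ) ≤ N := by exact_mod_cast hAN
  have hLN' : 2 * (L : ℝ) ≤ N := by exact_mod_cast hLN
  have hAmem : (A : ℝ) ∈ Set.Icc (A : ℝ) (3 * N) := ⟨le_rfl, by linarith⟩
  have hμ₂ : 0 < μ₂ := hμ₁.trans_le ((hf2 A hAmem).1.trans (hf2 A hAmem).2)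
  have hsplit : ∑ n ∈ Finset.Icc 1 N, F n
      = ∑ n ∈ Finset.Ico 1 A, F n + ∑ n ∈ Finset.Ico A (N + 1), F n := by
    rw [Finset.sum_Ico_consecutive _ hA (by omega)]
    rfl
  have hfirst : ‖∑ n ∈ Finset.Ico 1 A, F n‖ ≤ A := by
    refine (norm_sum_le _ _).trans
      ((Finset.sum_le_card_nsmul _ _ 1 fun n _ => hF1 n).trans ?_)
    rw [Nat.card_Ico, nsmul_eq_mul, mul_one]
    exact_mod_cast Nat.sub_le _ _
  have hwin := norm_sum_Ico_le_of_window (F := F) hF1 hL (show A ≤ N + 1 by omega)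
    (bad := fun n => NearInt (2 * K / Q) (f n)) (E := L * θ + 2 * (Q * K)) (by
      intro m hm
      rw [Finset.mem_Ico] at hm
      have hm1 : (A : ℝ) ≤ m := by exact_mod_cast hm.1
      have hm2 : (m : ℝ) ≤ N := by exact_mod_cast Nat.lt_succ_iff.mp hm.2
      have hsub : Set.Icc (m : ℝ) (m + 2 * L) ⊆ Set.Icc (A : ℝ) (3 * N) := fun t ht =>
        ⟨hm1.trans ht.1, by linarith [ht.2]⟩
      have h1 := norm_sum_window_le hf hK hKp hQ hQK hr0 hr x hy hKr hθ hθL (m := m)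
        (fun t ht => hf1 t (hsub ht)) (fun t ht => by
          have h2 : |deriv f t - deriv f m| ≤ 2 * L * μ₂ := by
            rcases ht.1.eq_or_lt with h | h
            · rw [← h, sub_self, abs_zero]
              positivity
            obtain ⟨ξ, hξ, hξ'⟩ := exists_deriv_eq_slope (deriv f) h
              hf'.continuous.continuousOn hf'.differentiableOn
            rw [eq_div_iff (sub_pos.mpr h).ne'] at hξ'
            obtain ⟨h3, h4⟩ := hf2 ξ (hsub ⟨hξ.1.le, hξ.2.le.trans ht.2⟩)
            rw [← hξ', abs_of_nonneg (mul_nonneg (hμ₁.le.trans h3) (sub_pos.mpr h).le), mul_comm]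
            exact mul_le_mul (by linarith [ht.2]) h4 (hμ₁.le.trans h3) (by positivity)
          exact (mul_le_mul_of_nonneg_right h2 (by positivity)).trans hμL) hML hMQ
      linarith)
  have hbad := card_filter_nearInt_le hf hf' (A := A) (B := N + 1 + L) (H := H) (by omega) hH
    (Δ := 2 * K / Q) hμ₁ (by positivity) (fun t ht => hf2 t ⟨ht.1, ht.2.trans (by
      push_cast
      linarith)⟩)
  have hW : ((N + 1 + L : ℕ) : ℝ) - A ≤ 3 * N := by
    push_cast
    linarith
  have hbad' : (((Finset.Ico A (N + 1 + L)).filter fun n : ℕ => NearInt (2 * K / Q) (f n)).card : ℝ)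
      ≤ 3 * N / H + 1 + H * (4 * (2 * K / Q) * (μ₂ / μ₁) * (3 * N)
        + H * μ₂ * (3 * N) + 8 * (2 * K / Q) / μ₁ + 2) := by
    refine hbad.trans ?_
    gcongr
  rw [hsplit]
  refine (norm_add_le _ _).trans ?_
  have h5 : ((N + 1 : ℕ) - A : ℝ) * ((L * θ + 2 * (Q * K)) / L)
      ≤ N * (θ + 2 * (Q * K) / L) := by
    rw [add_div, mul_div_cancel_left₀ _ hL'.ne']
    gcongr
    push_cast
    linarith
  linarith

end

open Filter in
lemma eventually_rpow_le_deriv_deriv {g : ℝ → ℝ} {κ η : ℝ} (hη : 0 < η)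
    (hpos : ∀ᶠ t in atTop, 0 < g t)
    (hlim : Tendsto (fun t => Real.log (g t) / Real.log t) atTop (nhds (-κ))) :
    ∀ᶠ t in atTop, t ^ (-κ - η) ≤ g t ∧ g t ≤ t ^ (-κ + η) := by
  have h1 := hlim.eventually (Icc_mem_nhds (show -κ - η < -κ by linarith)
    (show -κ < -κ + η by linarith))
  filter_upwards [h1, hpos, eventually_gt_atTop 1] with t ht hg ht1
  have hlog := Real.log_pos ht1
  have ht0 : 0 < t := by linarith
  rw [le_div_iff₀ hlog, div_le_iff₀ hlog] at ht
  rw [Real.rpow_def_of_pos ht0, Real.rpow_def_of_pos ht0, ← Real.le_log_iff_exp_le hg,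
    ← Real.log_le_iff_le_exp hg]
  constructor <;> linarith [ht.1, ht.2]

open Filter in
lemma eventually_deriv_bounds {g : ℝ → ℝ} (hg : Differentiable ℝ g) {κ η : ℝ} (hη : 0 < η)
    (hκ : κ + η ≤ 1) (h : ∀ᶠ t in atTop, t ^ (-κ - η) ≤ deriv g t ∧ deriv g t ≤ t ^ (-κ + η)) :
    ∀ᶠ t in atTop, 1 ≤ g t ∧ g t ≤ t ^ (1 - κ + 2 * η) := by
  obtain ⟨T₀, hT₀⟩ := eventually_atTop.mp h
  set T := max T₀ 1 with hT
  have hT1 : 1 ≤ T := le_max_right _ _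
  have hTd : ∀ t ≥ T, t ^ (-κ - η) ≤ deriv g t ∧ deriv g t ≤ t ^ (-κ + η) := fun t ht =>
    hT₀ t ((le_max_left _ _).trans ht)
  have ha : 0 < 1 - κ + η := by linarith
  have hlow : MonotoneOn (fun t => g t - Real.log t) (Set.Ici T) := by
    have hd : ∀ t ≥ T, HasDerivAt (fun t => g t - Real.log t) (deriv g t - t⁻¹) t := fun t ht =>
      (hg t).hasDerivAt.sub (Real.hasDerivAt_log (by linarith))
    refine monotoneOn_of_hasDerivWithinAt_nonneg (convex_Ici T)
      (fun t ht => (hd t ht).continuousAt.continuousWithinAt) (f' := fun t => deriv g t - t⁻¹)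
      (fun t ht => (hd t (interior_subset ht)).hasDerivWithinAt) fun t ht => ?_
    have ht := interior_subset ht
    have h1 : t⁻¹ ≤ t ^ (-κ - η) := by
      rw [← Real.rpow_neg_one]
      exact Real.rpow_le_rpow_of_exponent_le (hT1.trans ht) (by linarith)
    linarith [(hTd t ht).1]
  have hupp : AntitoneOn (fun t => g t - t ^ (1 - κ + η) / (1 - κ + η)) (Set.Ici T) := by
    have hd : ∀ t ≥ T, HasDerivAt (fun t => g t - t ^ (1 - κ + η) / (1 - κ + η))
        (deriv g t - t ^ (-κ + η)) t := fun t ht => by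
      have h1 := ((Real.hasDerivAt_rpow_const (x := t) (p := 1 - κ + η)
        (Or.inl (by linarith))).div_const (1 - κ + η))
      rw [mul_div_cancel_left₀ _ ha.ne', show 1 - κ + η - 1 = -κ + η by ring] at h1
      exact (hg t).hasDerivAt.sub h1
    refine antitoneOn_of_hasDerivWithinAt_nonpos (convex_Ici T)
      (fun t ht => (hd t ht).continuousAt.continuousWithinAt)
      (f' := fun t => deriv g t - t ^ (-κ + η))
      (fun t ht => (hd t (interior_subset ht)).hasDerivWithinAt) fun t ht => ?_
    linarith [(hTd t (interior_subset ht)).2]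
  have hη' := tendsto_rpow_atTop hη
  filter_upwards [eventually_ge_atTop T,
    Real.tendsto_log_atTop.eventually_ge_atTop (1 - g T + Real.log T),
    hη'.eventually_ge_atTop (|g T| + (1 - κ + η)⁻¹)] with t ht ht1 ht2
  have h1 := hlow Set.self_mem_Ici ht ht
  have h2 := hupp Set.self_mem_Ici ht ht
  simp only at h1 h2
  refine ⟨by linarith, ?_⟩
  have ht0 : 0 < t := by linarith
  have h3 : 1 ≤ t ^ (1 - κ + η) := Real.one_le_rpow (hT1.trans ht) ha.le
  have h4 : 0 ≤ T ^ (1 - κ + η) / (1 - κ + η) := by positivity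
  rw [show 1 - κ + 2 * η = (1 - κ + η) + η by ring, Real.rpow_add ht0]
  calc g t ≤ |g T| + t ^ (1 - κ + η) / (1 - κ + η) := by linarith [le_abs_self (g T)]
    _ ≤ t ^ (1 - κ + η) * |g T| + t ^ (1 - κ + η) * (1 - κ + η)⁻¹ := by
      rw [div_eq_mul_inv]
      gcongr
      exact le_mul_of_one_le_left (abs_nonneg _) h3
    _ = t ^ (1 - κ + η) * (|g T| + (1 - κ + η)⁻¹) := by ring
    _ ≤ _ := by gcongr

section
variable {p : ℕ} [Fact p.Prime]

set_option maxHeartbeats 2000000 in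
lemma norm_sum_Icc_psi_le_rpow {f : ℝ → ℝ} (hf : Differentiable ℝ f)
    (hf' : Differentiable ℝ (deriv f)) {κ ε e T : ℝ} (hκ₁ : 2 / 3 < κ) (hκ₂ : κ < 1)
    (hε : 0 < ε) (hε' : ε ≤ 1 - κ) (he : e = κ * ε)
    (hT : ∀ t ≥ T, (1 ≤ deriv f t ∧ deriv f t ≤ t ^ (1 - κ + 2 * (e / 256))) ∧
      t ^ (-κ - e / 256) ≤ deriv (deriv f) t ∧ deriv (deriv f) t ≤ t ^ (-κ + e / 256))
    {r : ℕ} (hr : r = ⌈2 / e⌉₊) (hpr : (r : ℝ) < (p : ℝ) ^ (e / 1024))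
    (hpT : T ≤ (p : ℝ) ^ (e / 1024)) (hp0 : 2000 ≤ (p : ℝ) ^ (e / 1024)) (x : ZMod p)
    {y : ZMod p} (hy : y ≠ 0) {N : ℕ} (hN₁ : (p : ℝ) ^ (1 / (2 * κ) + ε) ≤ (N : ℝ))
    (hN₂ : (N : ℝ) < (p : ℝ) ^ (1 / (2 - κ))) :
    ‖∑ n ∈ Finset.Icc 1 N, psi p x y ((⌊f n⌋ : ℤ) : ZMod p)‖
      ≤ (64 * (4 * r + r ^ r) + 1547) * N * (p : ℝ) ^ (-(ε ^ 2 * κ ^ 4 / 2 ^ 11)) := by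
  have hP1 : (1 : ℝ) < p := by exact_mod_cast (Fact.out : p.Prime).one_lt
  have hP0 : (0 : ℝ) < p := by linarith
  have hmul : ∀ a b : ℝ, (p : ℝ) ^ a * (p : ℝ) ^ b = (p : ℝ) ^ (a + b) := fun a b =>
    (Real.rpow_add hP0 a b).symm
  have hmono : ∀ {a b : ℝ}, a ≤ b → (p : ℝ) ^ a ≤ (p : ℝ) ^ b := fun h =>
    Real.rpow_le_rpow_of_exponent_le hP1.le h
  have hpos : ∀ a : ℝ, 0 < (p : ℝ) ^ a := fun a => Real.rpow_pos_of_pos hP0 a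
  have hone : ∀ {a : ℝ}, 0 ≤ a → 1 ≤ (p : ℝ) ^ a := fun h => Real.one_le_rpow hP1.le h
  -- exponents
  have he0 : 0 < e := he ▸ by positivity
  have hee : e ≤ 1 - κ := by
    rw [he]
    exact (mul_le_of_le_one_left hε.le hκ₂.le).trans hε'
  have he1 : e < 1 / 3 := by linarith
  have hr1 : 2 / e ≤ r := hr ▸ Nat.le_ceil _
  have hr2 : (r : ℝ) ≤ 3 / e := by
    have h1 : (r : ℝ) < 2 / e + 1 := hr ▸ Nat.ceil_lt_add_one (by positivity)
    have h2 : 1 ≤ 1 / e := by rw [le_div_iff₀ he0]; linarith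
    have h3 : 3 / e = 2 / e + 1 / e := by ring
    linarith
  have hrpos : (0 : ℝ) < r := lt_of_lt_of_le (by positivity) hr1
  have hr0 : 0 < r := by exact_mod_cast hrpos
  obtain ⟨k, hk⟩ : ∃ k : ℝ, k = 1 / (2 * r) := ⟨_, rfl⟩
  have hkr : k * r = 1 / 2 := by rw [hk]; field_simp
  have hk1 : k ≤ e / 4 := by
    rw [div_le_iff₀ he0] at hr1
    rw [hk, div_le_iff₀ (by positivity)]
    linarith
  have hk0 : 0 < k := by rw [hk]; positivity
  obtain ⟨δ, hδ⟩ : ∃ δ : ℝ, δ = ε ^ 2 * κ ^ 4 / 2 ^ 11 := ⟨_, rfl⟩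
  have hδ0 : 0 < δ := by rw [hδ]; positivity
  have hδe : δ ≤ e ^ 2 / 2048 := by
    rw [hδ, he]
    have h1 : κ ^ 2 ≤ 1 := pow_le_one₀ (by linarith) hκ₂.le
    linarith [mul_nonneg (sq_nonneg (κ * ε)) (sub_nonneg.mpr h1)]
  have hδe' : δ ≤ e / 2048 := by
    linarith [mul_le_mul_of_nonneg_left (show e ≤ 1 by linarith) he0.le]
  rw [← hδ]
  have hN0 : (0 : ℝ) < N := (hpos _).trans_le hN₁
  obtain ⟨ν, hν⟩ : ∃ ν : ℝ, ν = Real.logb p N := ⟨_, rfl⟩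
  have hNν : (N : ℝ) = (p : ℝ) ^ ν := by rw [hν, Real.rpow_logb hP0 hP1.ne' hN0]
  obtain ⟨w, hw⟩ : ∃ w : ℝ, w = κ * ν := ⟨_, rfl⟩
  have hw1 : 1 / 2 + e ≤ w := by
    rw [hNν, Real.rpow_le_rpow_left_iff hP1] at hN₁
    calc 1 / 2 + e = κ * (1 / (2 * κ) + ε) := by rw [he]; field_simp
      _ ≤ κ * ν := by gcongr
      _ = w := hw.symm
  have hν1 : ν ≤ 1 := by
    rw [hNν, Real.rpow_lt_rpow_left_iff hP1] at hN₂
    refine hN₂.le.trans ?_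
    rw [div_le_one (by linarith)]
    linarith
  have hκ0 : 0 < κ := by linarith
  have hν2 : 1 / 2 < ν := by
    by_contra! h
    linarith [mul_le_mul_of_nonneg_left h hκ0.le]
  have hνw1 : (1 - κ) / 2 ≤ ν - w := by
    linarith [mul_le_mul_of_nonneg_left hν2.le (sub_nonneg.mpr hκ₂.le)]
  have hνw2 : ν - w ≤ 1 / 3 := by
    linarith [mul_le_mul_of_nonneg_left hν1 (sub_nonneg.mpr hκ₂.le)]
  have heν : e * ν ≤ e := mul_le_of_le_one_right he0.le hν1
  have hexp₁ : ν * (1 - κ + 2 * (e / 256)) ≤ ν - w + e / 128 := by linarith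
  have hexp₂ : -w - e / 256 ≤ ν * (-κ - e / 256) := by linarith
  have hexp₃ : (ν - e / 256) * (-κ + e / 256) ≤ -w + e / 128 := by
    linarith [mul_le_of_le_one_right he0.le hκ₂.le, sq_nonneg e]
  have hexp₄ : -(3 * e / 16) ≤ -(e ^ 2 / 32) * (2 * r) := by
    rw [le_div_iff₀ he0] at hr2
    linarith [mul_le_mul_of_nonneg_left hr2 he0.le]
  have hceil : ∀ {z : ℝ}, 1 ≤ z → (⌈z⌉₊ : ℝ) ≤ 2 * z := fun h =>
    Nat.ceil_le_two_mul (by norm_num; linarith)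
  -- parameters
  obtain ⟨A, hA⟩ : ∃ A : ℕ, A = ⌈(p : ℝ) ^ (ν - e / 256)⌉₊ := ⟨_, rfl⟩
  have hA1 : (p : ℝ) ^ (ν - e / 256) ≤ A := hA ▸ Nat.le_ceil _
  have hA2 : (A : ℝ) ≤ 2 * (p : ℝ) ^ (ν - e / 256) := hA ▸ hceil (hone (by linarith))
  have hAT : T ≤ A := (hpT.trans (hmono (by linarith))).trans hA1
  have hApos : (0 : ℝ) < A := (hpos _).trans_le hA1
  have hAN : A ≤ N := by
    rw [hA, Nat.ceil_le, hNν]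
    exact hmono (by linarith)
  obtain ⟨K, hK⟩ : ∃ K : ℕ, K = ⌈(p : ℝ) ^ k⌉₊ := ⟨_, rfl⟩
  have hK1 : (p : ℝ) ^ k ≤ K := hK ▸ Nat.le_ceil _
  have hK2 : (K : ℝ) ≤ 2 * (p : ℝ) ^ k := hK ▸ hceil (hone hk0.le)
  have hKpos : (0 : ℝ) < K := (hpos _).trans_le hK1
  obtain ⟨Q, hQ⟩ : ∃ Q : ℕ, Q = ⌈K * (p : ℝ) ^ (e / 16)⌉₊ := ⟨_, rfl⟩
  have hQ1 : K * (p : ℝ) ^ (e / 16) ≤ Q := hQ ▸ Nat.le_ceil _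
  have hQpos : (0 : ℝ) < Q := (mul_pos hKpos (hpos _)).trans_le hQ1
  have hQ2 : (p : ℝ) ^ (k + e / 16) ≤ Q := by
    rw [← hmul]
    exact (mul_le_mul_of_nonneg_right hK1 (hpos _).le).trans hQ1
  have hQ3 : (Q : ℝ) ≤ 4 * (p : ℝ) ^ (k + e / 16) := by
    have h1 : 1 ≤ K * (p : ℝ) ^ (e / 16) :=
      one_le_mul_of_one_le_of_one_le ((hone hk0.le).trans hK1) (hone (by positivity))
    rw [← hmul]
    calc (Q : ℝ) ≤ 2 * (K * (p : ℝ) ^ (e / 16)) := hQ ▸ hceil h1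
      _ ≤ 2 * (2 * (p : ℝ) ^ k * (p : ℝ) ^ (e / 16)) := by gcongr
      _ = _ := by ring
  have hΔ : 2 * K / Q ≤ 2 * (p : ℝ) ^ (-(e / 16)) := by
    rw [div_le_iff₀ hQpos]
    have h1 : (p : ℝ) ^ (-(e / 16)) * (p : ℝ) ^ (e / 16) = 1 := by rw [hmul]; simp
    calc (2 : ℝ) * K = 2 * (p : ℝ) ^ (-(e / 16)) * (K * (p : ℝ) ^ (e / 16)) := by
          linear_combination (-2 * K : ℝ) * h1
      _ ≤ _ := by
        have := hpos (-(e / 16))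
        gcongr
  obtain ⟨z, hz⟩ : ∃ z : ℝ, z = (p : ℝ) ^ (w - e / 128) / (2 * Q ^ 2) := ⟨_, rfl⟩
  have hz1 : (p : ℝ) ^ (w - e / 128 - 2 * k - e / 8) / 32 ≤ z := by
    rw [hz, div_le_div_iff₀ (by norm_num) (by positivity)]
    calc (p : ℝ) ^ (w - e / 128 - 2 * k - e / 8) * (2 * Q ^ 2)
        ≤ (p : ℝ) ^ (w - e / 128 - 2 * k - e / 8) * (2 * (4 * (p : ℝ) ^ (k + e / 16)) ^ 2) := by
          have := hpos (w - e / 128 - 2 * k - e / 8)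
          gcongr
      _ = (p : ℝ) ^ (w - e / 128 - 2 * k - e / 8) * (p : ℝ) ^ (k + e / 16)
          * (p : ℝ) ^ (k + e / 16) * 32 := by ring
      _ = (p : ℝ) ^ (w - e / 128) * 32 := by rw [hmul, hmul]; ring_nf
  have hz2 : z ≤ (p : ℝ) ^ (w - e / 128 - 2 * k - e / 8) / 2 := by
    rw [hz, div_le_div_iff₀ (by positivity) (by norm_num)]
    calc (p : ℝ) ^ (w - e / 128) * 2 = (p : ℝ) ^ (w - e / 128 - 2 * k - e / 8)
          * (p : ℝ) ^ (k + e / 16) * (p : ℝ) ^ (k + e / 16) * 2 := by rw [hmul, hmul]; ring_nf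
      _ = (p : ℝ) ^ (w - e / 128 - 2 * k - e / 8) * (2 * ((p : ℝ) ^ (k + e / 16)) ^ 2) := by ring
      _ ≤ _ := by
          have := hpos (w - e / 128 - 2 * k - e / 8)
          have := hpos (k + e / 16)
          gcongr
  have hz3 : 1 ≤ z := by
    have := hp0.trans (hmono (show e / 1024 ≤ w - e / 128 - 2 * k - e / 8 by linarith))
    linarith
  obtain ⟨L, hL⟩ : ∃ L : ℕ, L = ⌊z⌋₊ := ⟨_, rfl⟩
  have hLz : (L : ℝ) ≤ z := hL ▸ Nat.floor_le (by linarith)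
  have hL1 : (p : ℝ) ^ (w - e / 128 - 2 * k - e / 8) / 64 ≤ L := by
    have h1 : z < L + 1 := hL ▸ Nat.lt_floor_add_one z
    have h2 : (1 : ℝ) ≤ L := by
      rw [hL]
      exact_mod_cast Nat.le_floor (by simpa using hz3)
    linarith
  have hL2 : (L : ℝ) ≤ (p : ℝ) ^ (w - e / 128 - 2 * k - e / 8) / 2 := hLz.trans hz2
  have hLpos : (0 : ℝ) < L := lt_of_lt_of_le (div_pos (hpos _) (by norm_num)) hL1
  obtain ⟨H, hH⟩ : ∃ H : ℕ, H = ⌈(p : ℝ) ^ (e / 64)⌉₊ := ⟨_, rfl⟩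
  have hH1 : (p : ℝ) ^ (e / 64) ≤ H := hH ▸ Nat.le_ceil _
  have hH2 : (H : ℝ) ≤ 2 * (p : ℝ) ^ (e / 64) := hH ▸ hceil (hone (by positivity))
  have hHpos : (0 : ℝ) < H := (hpos _).trans_le hH1
  obtain ⟨D, hD⟩ : ∃ D : ℝ, D = 64 * (4 * r + (r : ℝ) ^ r) := ⟨_, rfl⟩
  have hD1 : 1 ≤ D := by
    have h1 : (1 : ℝ) ≤ r := by exact_mod_cast hr0
    have h2 : (0 : ℝ) ≤ (r : ℝ) ^ r := by positivity
    rw [hD]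
    linarith
  have hsqrt : √(p : ℝ) = (p : ℝ) ^ (1 / 2 : ℝ) := Real.sqrt_eq_rpow _
  have hp12 : 2000 ≤ (p : ℝ) ^ (1 / 2 : ℝ) := hp0.trans (hmono (by linarith))
  have hp12' : (p : ℝ) ^ (1 / 2 : ℝ) * (p : ℝ) ^ (1 / 2 : ℝ) = p := by
    rw [hmul]
    norm_num
  have key := norm_sum_Icc_psi_le hf hf' (A := A) (N := N) (L := L) (Q := Q) (K := K) (H := H)
    (r := r) (θ := D * (p : ℝ) ^ (-(e ^ 2 / 32)))
    (μ₁ := (p : ℝ) ^ (-w - e / 256) / 3) (μ₂ := (p : ℝ) ^ (-w + e / 128))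
    (M := 3 * (p : ℝ) ^ (ν - w + e / 128))
    (by exact_mod_cast hApos) hAN ?hLN (by exact_mod_cast hKpos) ?hKp (by exact_mod_cast hQpos)
    ?hQK (by exact_mod_cast hHpos) hr0 ?hrp x hy ?hKr
    (mul_nonneg (by linarith) (hpos _).le) ?hθL (div_pos (hpos _) (by norm_num)) ?hf1 ?hf2 ?hμL
    ?hML ?hMQ
  case hLN =>
    have h1 : 2 * (L : ℝ) ≤ N := by
      rw [hNν]
      linarith [hmono (show w - e / 128 - 2 * k - e / 8 ≤ ν by linarith)]
    exact_mod_cast h1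
  case hKp =>
    have h1 : (K : ℝ) ≤ p := by
      linarith [hmono (show k ≤ 1 / 2 by linarith),
        mul_le_mul_of_nonneg_right hp12 (hpos (1 / 2)).le]
    exact_mod_cast h1
  case hQK =>
    have h1 : (Q : ℝ) * K ≤ L := by
      have h2 : (p : ℝ) ^ (e / 1024) * ((p : ℝ) ^ (k + e / 16) * (p : ℝ) ^ k)
          ≤ (p : ℝ) ^ (w - e / 128 - 2 * k - e / 8) := by
        rw [hmul, hmul]
        exact hmono (by linarith)
      have h3 : (Q : ℝ) * K ≤ 4 * (p : ℝ) ^ (k + e / 16) * (2 * (p : ℝ) ^ k) := by gcongr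
      have h4 := mul_le_mul_of_nonneg_right hp0 (mul_pos (hpos (k + e / 16)) (hpos k)).le
      linarith
    exact_mod_cast h1
  case hrp =>
    have h1 : (r : ℝ) < p := hpr.trans_le (by
      simpa using hmono (show e / 1024 ≤ 1 by linarith))
    exact_mod_cast h1
  case hKr =>
    calc √(p : ℝ) = ((p : ℝ) ^ k) ^ r := by
          rw [hsqrt, ← Real.rpow_natCast, ← Real.rpow_mul hP0.le, hkr]
      _ ≤ _ := by
          have := hpos k
          gcongr
  case hθL =>
    have h1 : D * (p : ℝ) ^ (-(3 * e / 16)) ≤ (D * (p : ℝ) ^ (-(e ^ 2 / 32))) ^ (2 * r) := by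
      rw [mul_pow]
      refine mul_le_mul (le_self_pow₀ hD1 (by omega)) ?_ (hpos _).le (by positivity)
      rw [← Real.rpow_natCast ((p : ℝ) ^ (-(e ^ 2 / 32))), ← Real.rpow_mul hP0.le]
      exact hmono (by exact_mod_cast hexp₄)
    have h2 : (p : ℝ) ^ (1 / 2 : ℝ) ≤ (p : ℝ) ^ (-(3 * e / 16))
        * (p : ℝ) ^ (w - e / 128 - 2 * k - e / 8) := by
      rw [hmul]
      exact hmono (by linarith)
    calc (4 * r + (r : ℝ) ^ r) * √p = D / 64 * (p : ℝ) ^ (1 / 2 : ℝ) := by rw [hsqrt, hD]; ring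
      _ ≤ D / 64 * ((p : ℝ) ^ (-(3 * e / 16)) * (p : ℝ) ^ (w - e / 128 - 2 * k - e / 8)) := by
          gcongr
      _ = D * (p : ℝ) ^ (-(3 * e / 16)) * ((p : ℝ) ^ (w - e / 128 - 2 * k - e / 8) / 64) := by ring
      _ ≤ _ := by gcongr
  case hf1 =>
    intro t ht
    obtain ⟨⟨h1, h2⟩, -⟩ := hT t (hAT.trans ht.1)
    refine ⟨h1, h2.trans ?_⟩
    have h3 : 0 ≤ 1 - κ + 2 * (e / 256) := by linarith
    have h4 : (3 : ℝ) ^ (1 - κ + 2 * (e / 256)) ≤ 3 := by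
      simpa using Real.rpow_le_rpow_of_exponent_le (show (1 : ℝ) ≤ 3 by norm_num)
        (show 1 - κ + 2 * (e / 256) ≤ 1 by linarith)
    calc t ^ (1 - κ + 2 * (e / 256)) ≤ (3 * N) ^ (1 - κ + 2 * (e / 256)) :=
          Real.rpow_le_rpow (hApos.le.trans ht.1) ht.2 h3
      _ = 3 ^ (1 - κ + 2 * (e / 256)) * (p : ℝ) ^ (ν * (1 - κ + 2 * (e / 256))) := by
          rw [Real.mul_rpow (by norm_num) hN0.le, hNν, ← Real.rpow_mul hP0.le]
      _ ≤ 3 * (p : ℝ) ^ (ν - w + e / 128) :=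
          mul_le_mul h4 (hmono hexp₁) (hpos _).le (by norm_num)
  case hf2 =>
    intro t ht
    obtain ⟨-, h1, h2⟩ := hT t (hAT.trans ht.1)
    have ht0 : 0 < t := hApos.trans_le ht.1
    constructor
    · refine le_trans ?_ h1
      have h4 : (1 / 3 : ℝ) ≤ 3 ^ (-κ - e / 256) := by
        have := Real.rpow_le_rpow_of_exponent_le (show (1 : ℝ) ≤ 3 by norm_num)
          (show -1 ≤ -κ - e / 256 by linarith)
        rwa [Real.rpow_neg_one, ← one_div] at this
      calc (p : ℝ) ^ (-w - e / 256) / 3 = 1 / 3 * (p : ℝ) ^ (-w - e / 256) := by ring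
        _ ≤ 3 ^ (-κ - e / 256) * (p : ℝ) ^ (ν * (-κ - e / 256)) :=
            mul_le_mul h4 (hmono hexp₂) (hpos _).le (by positivity)
        _ = (3 * N) ^ (-κ - e / 256) := by
            rw [Real.mul_rpow (by norm_num) hN0.le, hNν, ← Real.rpow_mul hP0.le]
        _ ≤ _ := Real.rpow_le_rpow_of_nonpos ht0 ht.2 (by linarith)
    · refine h2.trans ?_
      calc t ^ (-κ + e / 256) ≤ ((p : ℝ) ^ (ν - e / 256)) ^ (-κ + e / 256) :=
            Real.rpow_le_rpow_of_nonpos (hpos _) (hA1.trans ht.1) (by linarith)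
        _ = (p : ℝ) ^ ((ν - e / 256) * (-κ + e / 256)) := by rw [← Real.rpow_mul hP0.le]
        _ ≤ _ := hmono hexp₃
  case hμL =>
    have h1 : 2 * (L : ℝ) * Q ^ 2 ≤ (p : ℝ) ^ (w - e / 128) := by
      rw [hz, le_div_iff₀ (by positivity)] at hLz
      linarith
    calc 2 * L * (p : ℝ) ^ (-w + e / 128) * Q ^ 2
        = 2 * L * Q ^ 2 * (p : ℝ) ^ (-w + e / 128) := by ring
      _ ≤ (p : ℝ) ^ (w - e / 128) * (p : ℝ) ^ (-w + e / 128) := by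
          have := hpos (-w + e / 128)
          gcongr
      _ = 1 := by rw [hmul]; ring_nf; exact Real.rpow_zero _
  case hML =>
    have h1 : (p : ℝ) ^ (ν - w + e / 128) * (p : ℝ) ^ (w - e / 128 - 2 * k - e / 8)
        ≤ (p : ℝ) ^ (1 - e / 8) := by
      rw [hmul]
      exact hmono (by linarith)
    have h2 : (p : ℝ) ^ (e / 1024) * (p : ℝ) ^ (1 - e / 8) ≤ p := by
      rw [hmul]
      simpa using hmono (show e / 1024 + (1 - e / 8) ≤ 1 by linarith)
    have h3 := hone (show 0 ≤ 1 - e / 8 by linarith)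
    have h4 : 3 * (p : ℝ) ^ (ν - w + e / 128) * L ≤ 3 * (p : ℝ) ^ (ν - w + e / 128)
        * ((p : ℝ) ^ (w - e / 128 - 2 * k - e / 8) / 2) := by
      have := hpos (ν - w + e / 128)
      gcongr
    linarith [mul_le_mul_of_nonneg_right hp0 (hpos (1 - e / 8)).le]
  case hMQ =>
    have h1 : (p : ℝ) ^ (ν - w + e / 128) * (p : ℝ) ^ (k + e / 16) ≤ (p : ℝ) ^ (1 / 2 : ℝ) := by
      rw [hmul]
      exact hmono (by linarith)
    have h4 : 3 * (p : ℝ) ^ (ν - w + e / 128) * Q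
        ≤ 3 * (p : ℝ) ^ (ν - w + e / 128) * (4 * (p : ℝ) ^ (k + e / 16)) := by
      have := hpos (ν - w + e / 128)
      gcongr
    linarith [mul_le_mul_of_nonneg_right hp12 (hpos (1 / 2)).le]
  -- collect the error terms
  refine key.trans ?_
  set Y : ℝ := (p : ℝ) ^ (ν - δ) with hY
  have hgoal : (N : ℝ) * (p : ℝ) ^ (-δ) = Y := by rw [hNν, hmul, hY, sub_eq_add_neg]
  have hse : δ ≤ e ^ 2 / 32 := by linarith [sq_nonneg e]
  have b1 : (A : ℝ) ≤ 2 * Y := by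
    linarith [hmono (show ν - e / 256 ≤ ν - δ by linarith)]
  have b2 : 2 * (L : ℝ) ≤ Y := by
    linarith [hmono (show w - e / 128 - 2 * k - e / 8 ≤ ν - δ by linarith)]
  have b3 : N * (D * (p : ℝ) ^ (-(e ^ 2 / 32))) ≤ D * Y := by
    have h1 : (p : ℝ) ^ ν * (p : ℝ) ^ (-(e ^ 2 / 32)) ≤ Y := by
      rw [hmul]
      exact hmono (by linarith)
    rw [hNν]
    linarith [mul_le_mul_of_nonneg_left h1 (zero_le_one.trans hD1)]
  have b4 : N * (2 * (Q * K) / L) ≤ 1024 * Y := by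
    rw [← mul_div_assoc, div_le_iff₀ hLpos]
    have h1 : (p : ℝ) ^ ν * ((p : ℝ) ^ (k + e / 16) * (p : ℝ) ^ k)
        ≤ Y * (p : ℝ) ^ (w - e / 128 - 2 * k - e / 8) := by
      rw [hmul, hmul, hmul]
      exact hmono (by linarith)
    have h2 : (N : ℝ) * (2 * (Q * K))
        ≤ (p : ℝ) ^ ν * (2 * (4 * (p : ℝ) ^ (k + e / 16) * (2 * (p : ℝ) ^ k))) := by
      rw [hNν]
      have := hpos ν
      gcongr
    have h3 := mul_le_mul_of_nonneg_left hL1 (hpos (ν - δ)).le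
    linarith
  have b5 : 3 * (N : ℝ) / H ≤ 3 * Y := by
    rw [div_le_iff₀ hHpos]
    have h1 : (p : ℝ) ^ ν ≤ Y * (p : ℝ) ^ (e / 64) := by
      rw [hmul]
      exact hmono (by linarith)
    have h3 := mul_le_mul_of_nonneg_left hH1 (hpos (ν - δ)).le
    rw [hNν]
    linarith
  have b6 : 1 ≤ Y := hone (by linarith)
  have hμ : (p : ℝ) ^ (-w + e / 128) / ((p : ℝ) ^ (-w - e / 256) / 3)
      = 3 * (p : ℝ) ^ (3 * e / 256) := by
    have := (hpos (-w - e / 256)).ne'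
    rw [div_div_eq_mul_div, div_eq_iff this, mul_assoc, hmul, mul_comm]
    ring_nf
  have hμ' : ((p : ℝ) ^ (-w - e / 256) / 3)⁻¹ = 3 * (p : ℝ) ^ (w + e / 256) := by
    rw [inv_div, div_eq_iff (hpos _).ne', mul_assoc, hmul]
    ring_nf
    simp
  have hE := hpos (3 * e / 256)
  have hE' := hpos (w + e / 256)
  have hE'' := hpos (-w + e / 128)
  have hν' := hpos ν
  have b7 : H * (4 * (2 * K / Q) * (3 * (p : ℝ) ^ (3 * e / 256)) * (3 * N)) ≤ 144 * Y := by
    have h1 : (p : ℝ) ^ (e / 64) * (p : ℝ) ^ (-(e / 16)) * (p : ℝ) ^ (3 * e / 256) * (p : ℝ) ^ ν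
        ≤ Y := by
      rw [hmul, hmul, hmul]
      exact hmono (by linarith)
    calc H * (4 * (2 * K / Q) * (3 * (p : ℝ) ^ (3 * e / 256)) * (3 * N))
        ≤ (2 * (p : ℝ) ^ (e / 64)) * (4 * (2 * (p : ℝ) ^ (-(e / 16)))
          * (3 * (p : ℝ) ^ (3 * e / 256)) * (3 * (p : ℝ) ^ ν)) := by
          rw [hNν]
          gcongr
      _ = 144 * ((p : ℝ) ^ (e / 64) * (p : ℝ) ^ (-(e / 16)) * (p : ℝ) ^ (3 * e / 256)
          * (p : ℝ) ^ ν) := by ring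
      _ ≤ _ := by gcongr
  have b8 : H * (H * (p : ℝ) ^ (-w + e / 128) * (3 * N)) ≤ 12 * Y := by
    have h1 : (p : ℝ) ^ (e / 64) * (p : ℝ) ^ (e / 64) * (p : ℝ) ^ (-w + e / 128) * (p : ℝ) ^ ν
        ≤ Y := by
      rw [hmul, hmul, hmul]
      exact hmono (by linarith)
    calc H * (H * (p : ℝ) ^ (-w + e / 128) * (3 * N))
        ≤ (2 * (p : ℝ) ^ (e / 64)) * ((2 * (p : ℝ) ^ (e / 64)) * (p : ℝ) ^ (-w + e / 128)
          * (3 * (p : ℝ) ^ ν)) := by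
          rw [hNν]
          gcongr
      _ = 12 * ((p : ℝ) ^ (e / 64) * (p : ℝ) ^ (e / 64) * (p : ℝ) ^ (-w + e / 128)
          * (p : ℝ) ^ ν) := by ring
      _ ≤ _ := by gcongr
  have b9 : H * (8 * (2 * K / Q) * (3 * (p : ℝ) ^ (w + e / 256))) ≤ 96 * Y := by
    have h1 : (p : ℝ) ^ (e / 64) * (p : ℝ) ^ (-(e / 16)) * (p : ℝ) ^ (w + e / 256) ≤ Y := by
      rw [hmul, hmul]
      exact hmono (by linarith)
    calc H * (8 * (2 * K / Q) * (3 * (p : ℝ) ^ (w + e / 256)))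
        ≤ (2 * (p : ℝ) ^ (e / 64)) * (8 * (2 * (p : ℝ) ^ (-(e / 16)))
          * (3 * (p : ℝ) ^ (w + e / 256))) := by gcongr
      _ = 96 * ((p : ℝ) ^ (e / 64) * (p : ℝ) ^ (-(e / 16)) * (p : ℝ) ^ (w + e / 256)) := by ring
      _ ≤ _ := by gcongr
  have b10 : (H : ℝ) * 2 ≤ 4 * Y := by
    linarith [hmono (show e / 64 ≤ ν - δ by linarith)]
  rw [hμ, div_eq_mul_inv (8 * (2 * K / Q : ℝ)), hμ', ← hD, mul_assoc (D + 1547) (N : ℝ), hgoal]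
  linarith

end

theorem stmt_0 (κ : ℝ) (hκ₁ : 2 / 3 < κ) (hκ₂ : κ < 1) (f : ℝ → ℝ)
    (hf : Differentiable ℝ f) (hf' : Differentiable ℝ (deriv f))
    (hpos : ∀ᶠ t in Filter.atTop, 0 < deriv (deriv f) t)
    (hlim : Filter.Tendsto (fun t => Real.log (deriv (deriv f) t) / Real.log t)
      Filter.atTop (nhds (-κ))) :
    ∃ ε₀ > 0, ∀ ε : ℝ, 0 < ε → ε ≤ ε₀ → ∃ C > 0, ∀ p : ℕ, p.Prime →
      ∀ x y : ZMod p, y ≠ 0 → ∀ N : ℕ,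
        (p : ℝ) ^ (1 / (2 * κ) + ε) ≤ (N : ℝ) → (N : ℝ) < (p : ℝ) ^ (1 / (2 - κ)) →
        ‖∑ n ∈ Finset.Icc 1 N, psi p x y ((⌊f n⌋ : ℤ) : ZMod p)‖ ≤
          C * N * (p : ℝ) ^ (-(ε ^ 2 * κ ^ 4 / 2 ^ 11)) := by
  have hκ0 : 0 < κ := by linarith
  refine ⟨1 - κ, by linarith, fun ε hε hε' => ?_⟩
  have he0 : 0 < κ * ε := by positivity
  have he1 : κ * ε ≤ 1 - κ := (mul_le_of_le_one_left hε.le hκ₂.le).trans hε'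
  have h2 := eventually_rpow_le_deriv_deriv (show 0 < κ * ε / 256 by positivity) hpos hlim
  obtain ⟨T, hT⟩ := Filter.eventually_atTop.mp
    ((eventually_deriv_bounds hf' (by positivity) (by linarith) h2).and h2)
  set r := ⌈2 / (κ * ε)⌉₊ with hr
  set δ := ε ^ 2 * κ ^ 4 / 2 ^ 11 with hδ
  have hδ0 : 0 < δ := by positivity
  have htend := tendsto_rpow_atTop (show 0 < κ * ε / 1024 by positivity)
  obtain ⟨P₀, hP₀⟩ := Filter.eventually_atTop.mp
    ((htend.eventually_gt_atTop (r : ℝ)).and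
      ((htend.eventually_ge_atTop T).and (htend.eventually_ge_atTop 2000)))
  have hD : (0 : ℝ) < 64 * (4 * r + (r : ℝ) ^ r) + 1547 := by positivity
  have hP₁ : 0 ≤ (max P₀ 1) ^ δ := by positivity
  refine ⟨64 * (4 * r + (r : ℝ) ^ r) + 1547 + (max P₀ 1) ^ δ, by positivity, ?_⟩
  intro p hp x y hy N hN₁ hN₂
  have := Fact.mk hp
  have hp0 : (0 : ℝ) < p := by exact_mod_cast hp.pos
  rcases le_or_gt P₀ p with h | h
  · obtain ⟨h3, h4, h5⟩ := hP₀ p h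
    refine (norm_sum_Icc_psi_le_rpow hf hf' hκ₁ hκ₂ hε hε' rfl hT hr h3 h4 h5 x hy hN₁ hN₂).trans ?_
    refine mul_le_mul_of_nonneg_right (mul_le_mul_of_nonneg_right ?_ (Nat.cast_nonneg N))
      (Real.rpow_nonneg hp0.le _)
    linarith
  · have h3 : ‖∑ n ∈ Finset.Icc 1 N, psi p x y ((⌊f n⌋ : ℤ) : ZMod p)‖ ≤ N :=
      (norm_sum_le _ _).trans ((Finset.sum_le_card_nsmul _ _ 1
        fun n _ => norm_psi_le_one _ _ _).trans (by simp))
    have h4 : 1 ≤ (max P₀ 1) ^ δ * (p : ℝ) ^ (-δ) := by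
      rw [Real.rpow_neg hp0.le, ← div_eq_mul_inv, one_le_div (by positivity)]
      exact Real.rpow_le_rpow hp0.le (h.le.trans (le_max_left _ _)) hδ0.le
    calc _ ≤ (N : ℝ) := h3
      _ ≤ N * ((max P₀ 1) ^ δ * (p : ℝ) ^ (-δ)) := le_mul_of_one_le_right (Nat.cast_nonneg N) h4
      _ = (max P₀ 1) ^ δ * N * (p : ℝ) ^ (-δ) := by ring
      _ ≤ _ := by
        gcongr
        linarith
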